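/- arXiv:2509.03397 — 10 statements merged into one kernel-verified Lean document; each statement's English description precedes it below -/
import Mathlib

section
/- Let a, b, c be nonnegative integers with a + c ≥ b ≥ c > 0, and let (f_n(x))_{n≥0} be real polynomials with f_0(x) = 1 satisfying f_{n+1}(x) = (a n x + b x + c) f_n(x) + a x (1 - x) f_n'(x) for all n ≥ 0, and suppose deg f_n(x) = n for all n. Then for every n ≥ 1 the polynomial f_n(x) is bi-gamma-positive. -/
open Polynomial

/-- A real polynomial `p` (with symmetric coefficients) is gamma-positive if
`p = ∑ γ k * X^k * (1+X)^(deg p - 2k)` with all `γ k ≥ 0`. -/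
def GammaPositive (p : Polynomial ℝ) : Prop :=
  ∃ γ : ℕ → ℝ, (∀ k, 0 ≤ γ k) ∧
    p = ∑ k ∈ Finset.range (p.natDegree / 2 + 1),
      Polynomial.C (γ k) * Polynomial.X ^ k * (1 + Polynomial.X) ^ (p.natDegree - 2 * k)

/-- A real polynomial `f` of degree `n` is bi-gamma-positive if both parts of its
symmetric decomposition `f = a + X * b`, where
`a = (f - X^(n+1) f(1/X))/(1 - X)` and `b = (X^n f(1/X) - f)/(1 - X)`,
are gamma-positive.  (Here `X^n f(1/X)` is `Polynomial.reflect n f`.) -/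
def BiGammaPositive (f : Polynomial ℝ) : Prop :=
  ∃ a b : Polynomial ℝ,
    (1 - Polynomial.X) * a = f - Polynomial.X * Polynomial.reflect f.natDegree f ∧
    (1 - Polynomial.X) * b = Polynomial.reflect f.natDegree f - f ∧
    GammaPositive a ∧ GammaPositive b

theorem Polynomial.reflect_one_add_X_pow (m : ℕ) :
    reflect m ((1 + X) ^ m : Polynomial ℝ) = (1 + X) ^ m := by
  induction m with
  | zero => simp
  | succ m ih =>
    have h1 : ((1 + X : Polynomial ℝ)).natDegree ≤ 1 := by compute_degree
    have hm : ((1 + X : Polynomial ℝ) ^ m).natDegree ≤ m := by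
      simpa using natDegree_pow_le_of_le m h1
    rw [pow_succ, reflect_mul _ _ hm h1, ih, reflect_add, reflect_one_X, reflect_one, pow_one,
      add_comm X]

/-- The polynomials `∑ γ k * X ^ k * (1 + X) ^ (n - 2 * k)` with all `γ k ≥ 0`, i.e. the
gamma-positive polynomials with centre of symmetry `n / 2`. -/
def GammaCone (n : ℕ) (p : Polynomial ℝ) : Prop :=
  ∃ γ : ℕ → ℝ, (∀ k, 0 ≤ γ k) ∧
    p = ∑ k ∈ Finset.range (n / 2 + 1), C (γ k) * X ^ k * (1 + X) ^ (n - 2 * k)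

namespace GammaCone

variable {n : ℕ} {p q : Polynomial ℝ}

theorem zero (n : ℕ) : GammaCone n 0 := ⟨0, fun _ => le_rfl, by simp⟩

theorem add (hp : GammaCone n p) (hq : GammaCone n q) : GammaCone n (p + q) := by
  obtain ⟨γ, hγ, rfl⟩ := hp
  obtain ⟨δ, hδ, rfl⟩ := hq
  refine ⟨γ + δ, fun k => add_nonneg (hγ k) (hδ k), ?_⟩
  rw [← Finset.sum_add_distrib]
  refine Finset.sum_congr rfl fun k _ => ?_
  rw [Pi.add_apply, C_add]
  ring

theorem C_mul {r : ℝ} (hr : 0 ≤ r) (hp : GammaCone n p) : GammaCone n (C r * p) := by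
  obtain ⟨γ, hγ, rfl⟩ := hp
  refine ⟨fun k => r * γ k, fun k => mul_nonneg hr (hγ k), ?_⟩
  rw [Finset.mul_sum]
  refine Finset.sum_congr rfl fun k _ => ?_
  rw [Polynomial.C_mul]
  ring

theorem sum {ι : Type*} (s : Finset ι) (g : ι → Polynomial ℝ)
    (h : ∀ i ∈ s, GammaCone n (g i)) : GammaCone n (∑ i ∈ s, g i) :=
  Finset.sum_induction g (GammaCone n) (fun _ _ => add) (zero n) h

theorem X_pow_mul_one_add_X_pow {k m : ℕ} (h : 2 * k + m = n) :
    GammaCone n (X ^ k * (1 + X) ^ m) := by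
  refine ⟨fun i => if i = k then 1 else 0, fun i => by dsimp only; split_ifs <;> norm_num, ?_⟩
  rw [Finset.sum_eq_single k]
  · simp [show n - 2 * k = m by omega]
  · intro i _ hi
    simp [hi]
  · intro hk
    exact absurd (Finset.mem_range.2 (by omega)) hk

theorem X_mul (hp : GammaCone n p) : GammaCone (n + 2) (X * p) := by
  obtain ⟨γ, hγ, rfl⟩ := hp
  rw [Finset.mul_sum]
  refine sum _ _ fun k hk => ?_
  have hk := Finset.mem_range.1 hk
  have h := C_mul (hγ k) (X_pow_mul_one_add_X_pow
    (show 2 * (k + 1) + (n - 2 * k) = n + 2 by omega))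
  convert h using 1
  ring

theorem natDegree_le (hp : GammaCone n p) : p.natDegree ≤ n := by
  obtain ⟨γ, -, rfl⟩ := hp
  refine natDegree_sum_le_of_forall_le _ _ fun k hk => ?_
  have hk := Finset.mem_range.1 hk
  have h : (C (γ k) * X ^ k * (1 + X) ^ (n - 2 * k) : Polynomial ℝ).natDegree
      ≤ k + (n - 2 * k) * 1 := by
    refine natDegree_mul_le_of_le (natDegree_C_mul_X_pow_le _ _) (natDegree_pow_le_of_le _ ?_)
    compute_degree
  omega

theorem reflect_eq (hp : GammaCone n p) : reflect n p = p := by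
  obtain ⟨γ, -, rfl⟩ := hp
  have hsum : ∀ (s : Finset ℕ) (g : ℕ → Polynomial ℝ),
      reflect n (∑ k ∈ s, g k) = ∑ k ∈ s, reflect n (g k) := by
    intro s g
    ext i
    simp [coeff_reflect]
  rw [hsum]
  refine Finset.sum_congr rfl fun k hk => ?_
  have hk := Finset.mem_range.1 hk
  have h1 : ((1 + X : Polynomial ℝ)).natDegree ≤ 1 := by compute_degree
  have hm : ((1 + X : Polynomial ℝ) ^ (n - 2 * k)).natDegree ≤ n - 2 * k := by
    simpa using natDegree_pow_le_of_le (n - 2 * k) h1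
  have hX : (C (γ k) * X ^ k : Polynomial ℝ).natDegree ≤ 2 * k :=
    (natDegree_C_mul_X_pow_le _ _).trans (by omega)
  conv_lhs => rw [show n = 2 * k + (n - 2 * k) by omega]
  rw [show 2 * k + (n - 2 * k) - 2 * k = n - 2 * k by omega, reflect_mul _ _ hX hm,
    reflect_one_add_X_pow, reflect_C_mul_X_pow, revAt_le (by omega),
    show 2 * k - k = k by omega]

theorem gammaPositive (hp : GammaCone n p) (h0 : p.coeff 0 ≠ 0) : GammaPositive p := by
  have hn : p.natDegree = n := by
    refine natDegree_eq_of_le_of_coeff_ne_zero hp.natDegree_le ?_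
    rw [← hp.reflect_eq, coeff_reflect, revAt_le le_rfl, Nat.sub_self]
    exact h0
  unfold GammaPositive
  rw [hn]
  exact hp

/-- The symmetrised Eulerian operator, which raises the centre of symmetry by `1 / 2`,
preserves gamma-positivity. -/
theorem eulerian {a s : ℝ} (ha : 0 ≤ a) (hs : 0 ≤ s) (hp : GammaCone n p) :
    GammaCone (n + 1)
      ((C (a * n) * X + C s * (1 + X)) * p + C a * X * (1 - X) * derivative p) := by
  obtain ⟨γ, hγ, rfl⟩ := hp
  rw [derivative_sum, Finset.mul_sum, Finset.mul_sum, ← Finset.sum_add_distrib]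
  refine sum _ _ fun k hk => ?_
  have hk := Finset.mem_range.1 hk
  obtain ⟨m, hm⟩ : ∃ m, n = 2 * k + m := ⟨n - 2 * k, by omega⟩
  rw [show n - 2 * k = m by omega]
  have hkey : (C (a * n) * X + C s * (1 + X)) * (C (γ k) * X ^ k * (1 + X) ^ m) +
      C a * X * (1 - X) * derivative (C (γ k) * X ^ k * (1 + X) ^ m) =
      C (γ k) * (C (s + a * k) * (X ^ k * (1 + X) ^ (m + 1)) +
        C (2 * a * m) * (X ^ (k + 1) * (1 + X) ^ (m - 1))) := by
    subst hm
    rcases k with _ | k <;> rcases m with _ | m <;>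
    · simp [derivative_mul, derivative_pow, C_ofNat]
      ring
  rw [hkey]
  refine C_mul (hγ k) (add (C_mul (by positivity) (X_pow_mul_one_add_X_pow (by omega))) ?_)
  rcases m with _ | m
  · simpa using zero (n + 1)
  · exact C_mul (by positivity) (X_pow_mul_one_add_X_pow (by omega))

end GammaCone

theorem gammaPositive_zero : GammaPositive 0 := ⟨0, fun _ => le_rfl, by simp⟩

/-- A polynomial of degree `m + 1` presented by its symmetric decomposition. -/
theorem biGammaPositive_of_eq_add_X_mul {m : ℕ} {f p q : Polynomial ℝ}
    (hf : f.natDegree = m + 1) (hpq : f = p + X * q) (hp : GammaCone (m + 1) p)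
    (hq : GammaCone m q) (hp0 : p.coeff 0 ≠ 0) (hq0 : q = 0 ∨ q.coeff 0 ≠ 0) :
    BiGammaPositive f := by
  have hX : reflect (m + 1) (X * q) = q := by
    rw [add_comm m, reflect_mul _ _ natDegree_X_le hq.natDegree_le, reflect_one_X, one_mul,
      hq.reflect_eq]
  have hr : reflect f.natDegree f = p + q := by
    rw [hf, hpq, reflect_add, hp.reflect_eq, hX]
  refine ⟨p, q, ?_, ?_, hp.gammaPositive hp0, ?_⟩
  · rw [hr, hpq]
    ring
  · rw [hr, hpq]
    ring
  · rcases hq0 with rfl | hq0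
    · exact gammaPositive_zero
    · exact hq.gammaPositive hq0

/-- under the Eulerian-type recurrence with `a + c ≥ b ≥ c > 0`,
every `f n` (`n ≥ 1`) is bi-gamma-positive. -/
theorem stmt0 (a b c : ℕ) (hc : 0 < c) (hcb : c ≤ b) (hba : b ≤ a + c)
    (f : ℕ → Polynomial ℝ) (hf0 : f 0 = 1)
    (hrec : ∀ n : ℕ, f (n + 1) =
      (Polynomial.C ((a : ℝ) * n + (b : ℝ)) * Polynomial.X + Polynomial.C (c : ℝ)) * f n +
        Polynomial.C (a : ℝ) * Polynomial.X * (1 - Polynomial.X) *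
          Polynomial.derivative (f n))
    (hdeg : ∀ n : ℕ, (f n).natDegree = n) :
    ∀ n : ℕ, 1 ≤ n → BiGammaPositive (f n) := by
  have ha : (0 : ℝ) ≤ a := a.cast_nonneg
  have hc' : (0 : ℝ) < c := Nat.cast_pos.2 hc
  have hcb' : (0 : ℝ) ≤ b - c := sub_nonneg.2 (Nat.cast_le.2 hcb)
  have hba' : (0 : ℝ) ≤ a + c - b := sub_nonneg.2 (by exact_mod_cast hba)
  have hb' : (0 : ℝ) < b := by linarith
  have decomposition : ∀ m : ℕ, ∃ p q : Polynomial ℝ, f (m + 1) = p + X * q ∧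
      GammaCone (m + 1) p ∧ GammaCone m q ∧ 0 < p.coeff 0 ∧
      ((b : ℝ) = c ∧ q = 0 ∨ (b : ℝ) ≠ c ∧ 0 < q.coeff 0) := by
    intro m
    induction m with
    | zero =>
      refine ⟨C (c : ℝ) * (1 + X), C ((b : ℝ) - c), ?_, ?_, ?_, by simpa using hc, ?_⟩
      · rw [hrec, hf0]
        simp
        ring
      · simpa using GammaCone.C_mul hc'.le
          (GammaCone.X_pow_mul_one_add_X_pow (show 2 * 0 + 1 = 0 + 1 by rfl))
      · simpa using GammaCone.C_mul hcb'
          (GammaCone.X_pow_mul_one_add_X_pow (show 2 * 0 + 0 = 0 by rfl))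
      · by_cases h : (b : ℝ) = c
        · exact Or.inl ⟨h, by simp [h]⟩
        · refine Or.inr ⟨h, ?_⟩
          rw [coeff_C_zero]
          exact lt_of_le_of_ne hcb' (sub_ne_zero.2 h).symm
    | succ m ih =>
      obtain ⟨p, q, hf, hp, hq, hp0, hq0⟩ := ih
      refine ⟨((C ((a : ℝ) * (m + 1 : ℕ)) * X + C (c : ℝ) * (1 + X)) * p +
          C (a : ℝ) * X * (1 - X) * derivative p) + C ((a : ℝ) + c - b) * (X * q),
        ((C ((a : ℝ) * m) * X + C (b : ℝ) * (1 + X)) * q +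
          C (a : ℝ) * X * (1 - X) * derivative q) + C ((b : ℝ) - c) * p,
        ?_, (hp.eulerian ha hc'.le).add (hq.X_mul.C_mul hba'),
        (hq.eulerian ha hb'.le).add (hp.C_mul hcb'), ?_, ?_⟩
      · rw [hrec, hf]
        simp
        ring
      · simpa [mul_coeff_zero] using mul_pos hc' hp0
      · rcases hq0 with ⟨h, rfl⟩ | ⟨h, hq0⟩
        · exact Or.inl ⟨h, by simp [h]⟩
        · refine Or.inr ⟨h, ?_⟩
          have := add_pos_of_pos_of_nonneg (mul_pos hb' hq0) (mul_nonneg hcb' hp0.le)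
          simpa [mul_coeff_zero] using this
  intro n hn
  obtain ⟨m, rfl⟩ := Nat.exists_eq_add_of_le' hn
  obtain ⟨p, q, hf, hp, hq, hp0, hq0⟩ := decomposition m
  exact biGammaPositive_of_eq_add_X_mul (hdeg _) hf hp hq hp0.ne'
    (hq0.imp And.right fun h => h.2.ne')
end

section
/- Let a, b, c be nonnegative integers with a + c ≥ b ≥ c > 0, and let (f_n(x))_{n≥0} be real polynomials with f_0(x) = 1 satisfying f_{n+1}(x) = (a n x + b x + c) f_n(x) + a x (1 - x) f_n'(x) for all n ≥ 0, and suppose deg f_n(x) = n for all n. Then for every n ≥ 1 the reciprocal polynomial x^n f_n(1/x) is ratio monotone. -/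
open Polynomial

/-- A real polynomial `p = a_0 + a_1 X + ⋯ + a_n X^n` of degree `n` with positive
coefficients is ratio monotone if
`a_n/a_0 ≤ a_(n-1)/a_1 ≤ ⋯ ≤ a_(n-⌊(n-1)/2⌋)/a_(⌊(n-1)/2⌋) ≤ 1` and
`a_0/a_(n-1) ≤ a_1/a_(n-2) ≤ ⋯ ≤ a_(⌊n/2⌋-1)/a_(n-⌊n/2⌋) ≤ 1`. -/
def RatioMonotone (p : Polynomial ℝ) : Prop :=
  (∀ i ≤ p.natDegree, 0 < p.coeff i) ∧
  (∀ i : ℕ, i + 1 ≤ (p.natDegree - 1) / 2 →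
    p.coeff (p.natDegree - i) / p.coeff i ≤
      p.coeff (p.natDegree - (i + 1)) / p.coeff (i + 1)) ∧
  (p.coeff (p.natDegree - (p.natDegree - 1) / 2) / p.coeff ((p.natDegree - 1) / 2) ≤ 1) ∧
  (∀ i : ℕ, i + 2 ≤ p.natDegree / 2 →
    p.coeff i / p.coeff (p.natDegree - 1 - i) ≤
      p.coeff (i + 1) / p.coeff (p.natDegree - 1 - (i + 1))) ∧
  (1 ≤ p.natDegree / 2 →
    p.coeff (p.natDegree / 2 - 1) / p.coeff (p.natDegree - p.natDegree / 2) ≤ 1)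

/-- The triangular array `g` obeys the Eulerian-type recurrence with parameters `a, b, c`;
its `n`-th row is supported on `1, …, n + 1`. -/
structure EulerianArray (a b c : ℝ) (g : ℕ → ℕ → ℝ) : Prop where
  apex : g 0 1 = 1
  left : ∀ n, g n 0 = 0
  right : ∀ n k, n + 1 < k → g n k = 0
  step : ∀ n k : ℕ, g (n + 1) (k + 1) =
    (a * k + c) * g n (k + 1) + (a * (n + 1 - k) + b) * g n k

/-- The bilinear inequality behind both families of ratio inequalities. -/
theorem eulerian_step_mul_le {a b c s t x₀ x₁ x₂ y₀ y₁ y₂ : ℝ} (ha : 0 ≤ a) (hc : 0 ≤ c)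
    (hcb : c ≤ b) (hs : 0 ≤ s) (ht : 0 ≤ t) (hx₀ : 0 ≤ x₀) (hx₁ : 0 < x₁) (hx₂ : 0 ≤ x₂)
    (hy₀ : 0 ≤ y₀) (hy₁ : 0 < y₁) (hy₂ : 0 ≤ y₂) (h₁ : x₀ * y₁ ≤ x₁ * y₂)
    (h₂ : x₁ * y₀ ≤ x₂ * y₁) (h₃ : x₂ * y₂ ≤ x₁ * y₁) :
    ((s + c) * x₁ + (t + a + b) * x₀) * ((t + c) * y₁ + (s + a + b) * y₀) ≤
      ((s + a + c) * x₂ + (t + b) * x₁) * ((t + a + c) * y₂ + (s + b) * y₁) := by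
  have h₄ : x₀ * y₀ ≤ x₂ * y₂ := by
    have h := mul_le_mul h₁ h₂ (by positivity) (by positivity)
    refine le_of_mul_le_mul_right (a := x₁ * y₁) ?_ (by positivity)
    linarith
  have h₅ : 2 * (x₀ * y₀) ≤ x₁ * y₂ + x₂ * y₁ := by
    refine two_mul_le_add_of_sq_le_mul (by positivity) (by positivity) ?_
    calc (x₀ * y₀) ^ 2 = (x₀ * y₀) * (x₀ * y₀) := sq _
      _ ≤ (x₂ * y₂) * (x₁ * y₁) :=
        mul_le_mul h₄ (h₄.trans h₃) (by positivity) (by positivity)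
      _ = x₁ * y₂ * (x₂ * y₁) := by ring
  have hb : 0 ≤ b := hc.trans hcb
  have hd : 0 ≤ b - c := sub_nonneg.2 hcb
  have e₁ : 0 ≤ (s + a + c) * (t + a + c) * (x₂ * y₂ - x₀ * y₀) :=
    mul_nonneg (by positivity) (sub_nonneg.2 h₄)
  have e₂ : 0 ≤ (t + c) * (t + a + b) * (x₁ * y₂ - x₀ * y₁) :=
    mul_nonneg (by positivity) (sub_nonneg.2 h₁)
  have e₃ : 0 ≤ (s + c) * (s + a + b) * (x₂ * y₁ - x₁ * y₀) :=
    mul_nonneg (by positivity) (sub_nonneg.2 h₂)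
  have e₄ : 0 ≤ (b - c) * ((s + t + b + c) * (x₁ * y₁ - x₀ * y₀)) :=
    mul_nonneg hd (mul_nonneg (by positivity) (sub_nonneg.2 (h₄.trans h₃)))
  have e₅ : 0 ≤ (b - c) * (a * (x₁ * y₂ + x₂ * y₁ - 2 * (x₀ * y₀))) :=
    mul_nonneg hd (mul_nonneg ha (sub_nonneg.2 h₅))
  linear_combination e₁ + e₂ + e₃ + e₄ + e₅

namespace EulerianArray

variable {a b c : ℝ} {g : ℕ → ℕ → ℝ}

theorem pos (hg : EulerianArray a b c g) (ha : 0 ≤ a) (hb : 0 < b) (hc : 0 < c) (n k : ℕ)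
    (hk : k ≤ n) : 0 < g n (k + 1) := by
  induction n generalizing k with
  | zero =>
    obtain rfl : k = 0 := by omega
    simp [hg.apex]
  | succ n ih =>
    rw [hg.step]
    rcases hk.lt_or_eq with h | rfl
    · have h₁ := ih k (by omega)
      have h₂ : 0 ≤ g n k := by
        cases k with
        | zero => rw [hg.left]
        | succ k => exact (ih k (by omega)).le
      have h₃ : (0 : ℝ) ≤ n + 1 - k := by
        have : (k : ℝ) ≤ n + 1 := by exact_mod_cast hk
        linarith
      positivity
    · rw [hg.right n (n + 1 + 1) (by omega)]
      have := ih n le_rfl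
      push_cast
      simp only [sub_self, mul_zero, zero_add]
      positivity

theorem nonneg (hg : EulerianArray a b c g) (ha : 0 ≤ a) (hb : 0 < b) (hc : 0 < c) (n k : ℕ) :
    0 ≤ g n k := by
  cases k with
  | zero => rw [hg.left]
  | succ k =>
    by_cases h : k ≤ n
    · exact (hg.pos ha hb hc n k h).le
    · rw [hg.right n _ (by omega)]

theorem mul_le_mul_and (hg : EulerianArray a b c g) (ha : 0 ≤ a) (hc : 0 < c) (hcb : c ≤ b)
    (hba : b ≤ a + c) (n : ℕ) :
    (∀ p q, p + q = n + 1 → g n p * g n q ≤ g n (p + 1) * g n (q + 1)) ∧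
      ∀ p q, p + q = n + 2 → g n (p + 1) * g n (q + 1) ≤ g n p * g n q := by
  have hb : 0 < b := hc.trans_le hcb
  have hpos := hg.pos ha hb hc
  have hnn := hg.nonneg ha hb hc
  induction n with
  | zero =>
    constructor
    · intro p q h
      have h₀ := hg.left 0
      obtain ⟨rfl, rfl⟩ | ⟨rfl, rfl⟩ : (p = 0 ∧ q = 1) ∨ (p = 1 ∧ q = 0) := by omega
      · rw [h₀, zero_mul]
        exact mul_nonneg (hnn _ _) (hnn _ _)
      · rw [h₀, mul_zero]
        exact mul_nonneg (hnn _ _) (hnn _ _)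
    · intro p q h
      have : g 0 (p + 1) * g 0 (q + 1) = 0 := by
        rcases Nat.eq_zero_or_pos p with rfl | hp
        · rw [hg.right 0 (q + 1) (by omega), mul_zero]
        · rw [hg.right 0 (p + 1) (by omega), zero_mul]
      rw [this]
      exact mul_nonneg (hnn _ _) (hnn _ _)
  | succ n ih =>
    obtain ⟨ihA, ihB⟩ := ih
    constructor
    · rintro (_ | i) (_ | j) h
      · omega
      · rw [hg.left, zero_mul]
        exact mul_nonneg (hnn _ _) (hnn _ _)
      · rw [hg.left, mul_zero]
        exact mul_nonneg (hnn _ _) (hnn _ _)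
      · have hn : (n : ℝ) = i + j := by
          have : n = i + j := by omega
          exact_mod_cast this
        have key := eulerian_step_mul_le (s := a * i) (t := a * j) ha hc.le hcb (by positivity)
          (by positivity) (hnn n i) (hpos n i (by omega)) (hnn n (i + 2)) (hnn n j)
          (hpos n j (by omega)) (hnn n (j + 2)) (ihA i (j + 1) (by omega))
          (ihA (i + 1) j (by omega)) (ihB (i + 1) (j + 1) (by omega))
        rw [hg.step n i, hg.step n j, hg.step n (i + 1), hg.step n (j + 1), hn]
        push_cast
        convert key using 1 <;> ring
    · intro p q h
      rcases lt_or_ge p 2 with hp | hp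
      · rw [hg.right (n + 1) (q + 1) (by omega), mul_zero]
        exact mul_nonneg (hnn _ _) (hnn _ _)
      rcases lt_or_ge q 2 with hq | hq
      · rw [hg.right (n + 1) (p + 1) (by omega), zero_mul]
        exact mul_nonneg (hnn _ _) (hnn _ _)
      obtain ⟨k, rfl⟩ := Nat.exists_eq_add_of_le' hp
      obtain ⟨l, rfl⟩ := Nat.exists_eq_add_of_le' hq
      have hn : (n : ℝ) = k + l + 1 := by
        have : n = k + l + 1 := by omega
        exact_mod_cast this
      have key := eulerian_step_mul_le (s := a * l) (t := a * k) ha hb.le hba (by positivity)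
        (by positivity) (hnn n (k + 3)) (hpos n (k + 1) (by omega)) (hnn n (k + 1))
        (hnn n (l + 3)) (hpos n (l + 1) (by omega)) (hnn n (l + 1))
        (ihB (k + 2) (l + 1) (by omega)) (ihB (k + 1) (l + 2) (by omega)) (ihA (k + 1) (l + 1) (by omega))
      rw [hg.step n (k + 1), hg.step n (l + 1), hg.step n (k + 2), hg.step n (l + 2), hn]
      push_cast
      convert key using 1 <;> ring

end EulerianArray

theorem eulerianArray_coeff_X_mul {a b c : ℝ} {f : ℕ → Polynomial ℝ} (hf0 : f 0 = 1)
    (hrec : ∀ n : ℕ, f (n + 1) =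
      (Polynomial.C (a * n + b) * Polynomial.X + Polynomial.C c) * f n +
        Polynomial.C a * Polynomial.X * (1 - Polynomial.X) * Polynomial.derivative (f n))
    (hdeg : ∀ n : ℕ, (f n).natDegree = n) :
    EulerianArray a b c fun n k => (X * f n).coeff k where
  apex := by simp [hf0]
  left n := by simp
  right n k hk := by
    obtain ⟨k, rfl⟩ : ∃ m, k = m + 1 := ⟨k - 1, by omega⟩
    rw [coeff_X_mul]
    exact coeff_eq_zero_of_natDegree_lt (by rw [hdeg]; omega)
  step n k := by
    have h : f (n + 1) = C (a * n + b) * (X * f n) + C c * f n +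
        C a * (X * derivative (f n)) - C a * (X * (X * derivative (f n))) := by
      rw [hrec]
      ring
    rw [coeff_X_mul, coeff_X_mul, h]
    simp only [coeff_add, coeff_sub, coeff_C_mul]
    rcases k with _ | _ | k
    · simp
    · simp [coeff_derivative]
      ring
    · simp [coeff_derivative]
      ring

/-- under the Eulerian-type recurrence with `a + c ≥ b ≥ c > 0`,
the reciprocal polynomial `X^n * (f n)(1/X)` is ratio monotone for every `n ≥ 1`. -/
theorem stmt1 (a b c : ℕ) (hc : 0 < c) (hcb : c ≤ b) (hba : b ≤ a + c)
    (f : ℕ → Polynomial ℝ) (hf0 : f 0 = 1)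
    (hrec : ∀ n : ℕ, f (n + 1) =
      (Polynomial.C ((a : ℝ) * n + (b : ℝ)) * Polynomial.X + Polynomial.C (c : ℝ)) * f n +
        Polynomial.C (a : ℝ) * Polynomial.X * (1 - Polynomial.X) *
          Polynomial.derivative (f n))
    (hdeg : ∀ n : ℕ, (f n).natDegree = n) :
    ∀ n : ℕ, 1 ≤ n → RatioMonotone (Polynomial.reflect n (f n)) := by
  intro n hn
  have hg := eulerianArray_coeff_X_mul hf0 hrec hdeg
  have hc' : (0 : ℝ) < c := by exact_mod_cast hc
  have hcb' : (c : ℝ) ≤ b := by exact_mod_cast hcb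
  have hba' : (b : ℝ) ≤ a + c := by exact_mod_cast hba
  have hpos : ∀ k ≤ n, 0 < (f n).coeff k := by
    intro k hk
    simpa [coeff_X_mul] using hg.pos (Nat.cast_nonneg a) (hc'.trans_le hcb') hc' n k hk
  obtain ⟨hA, hB⟩ := hg.mul_le_mul_and (Nat.cast_nonneg a) hc' hcb' hba' n
  have hup : ∀ i j, i + j + 1 = n →
      (f n).coeff i * (f n).coeff j ≤ (f n).coeff (i + 1) * (f n).coeff (j + 1) := by
    intro i j h
    simpa only [coeff_X_mul] using hA (i + 1) (j + 1) (by omega)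
  have hdown : ∀ i j, i + j = n →
      (f n).coeff (i + 1) * (f n).coeff (j + 1) ≤ (f n).coeff i * (f n).coeff j := by
    intro i j h
    simpa only [coeff_X_mul] using hB (i + 1) (j + 1) (by omega)
  have hcoeff : ∀ k ≤ n, (reflect n (f n)).coeff k = (f n).coeff (n - k) := by
    intro k hk
    rw [coeff_reflect, revAt_le hk]
  have hnd : (reflect n (f n)).natDegree = n := by
    refine natDegree_eq_of_le_of_coeff_ne_zero ?_ ?_
    · refine natDegree_le_iff_coeff_eq_zero.2 fun k hk => ?_
      rw [coeff_reflect, revAt_eq_self_of_lt hk]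
      exact coeff_eq_zero_of_natDegree_lt (by rwa [hdeg])
    · rw [hcoeff n le_rfl, Nat.sub_self]
      exact (hpos 0 (Nat.zero_le n)).ne'
  unfold RatioMonotone
  rw [hnd]
  refine ⟨fun i hi => ?_, fun i hi => ?_, ?_, fun i hi => ?_, fun h => ?_⟩
  · rw [hcoeff i hi]
    exact hpos _ (Nat.sub_le n i)
  · obtain ⟨j, rfl⟩ : ∃ j, n = i + j + 1 := ⟨n - i - 1, by omega⟩
    rw [hcoeff _ (by omega), hcoeff _ (by omega), hcoeff _ (by omega), hcoeff _ (by omega),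
      show i + j + 1 - (i + j + 1 - i) = i by omega, show i + j + 1 - i = j + 1 by omega,
      show i + j + 1 - (i + j + 1 - (i + 1)) = i + 1 by omega,
      show i + j + 1 - (i + 1) = j by omega,
      div_le_div_iff₀ (hpos _ (by omega)) (hpos _ (by omega))]
    exact hup i j rfl
  · obtain ⟨m, rfl | rfl⟩ : ∃ m, n = 2 * m + 1 ∨ n = 2 * m + 2 := ⟨(n - 1) / 2, by omega⟩
    · rw [hcoeff _ (by omega), hcoeff _ (by omega),
        show 2 * m + 1 - (2 * m + 1 - (2 * m + 1 - 1) / 2) = m by omega,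
        show 2 * m + 1 - (2 * m + 1 - 1) / 2 = m + 1 by omega,
        div_le_one (hpos _ (by omega))]
      exact (mul_self_le_mul_self_iff (hpos _ (by omega)).le (hpos _ (by omega)).le).2 (hup m m (by omega))
    · rw [hcoeff _ (by omega), hcoeff _ (by omega),
        show 2 * m + 2 - (2 * m + 2 - (2 * m + 2 - 1) / 2) = m by omega,
        show 2 * m + 2 - (2 * m + 2 - 1) / 2 = m + 2 by omega,
        div_le_one (hpos _ (by omega))]
      have h := hup m (m + 1) (by omega)
      rw [mul_comm] at h
      exact le_of_mul_le_mul_left h (hpos _ (by omega))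
  · obtain ⟨j, rfl⟩ : ∃ j, n = i + j + 2 := ⟨n - i - 2, by omega⟩
    rw [hcoeff _ (by omega), hcoeff _ (by omega), hcoeff _ (by omega), hcoeff _ (by omega),
      show i + j + 2 - i = j + 1 + 1 by omega,
      show i + j + 2 - (i + j + 2 - 1 - i) = i + 1 by omega,
      show i + j + 2 - (i + 1) = j + 1 by omega,
      show i + j + 2 - (i + j + 2 - 1 - (i + 1)) = i + 1 + 1 by omega,
      div_le_div_iff₀ (hpos _ (by omega)) (hpos _ (by omega))]
    exact hdown (j + 1) (i + 1) (by omega)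
  · obtain ⟨m, rfl | rfl⟩ : ∃ m, n = 2 * m ∨ n = 2 * m + 1 := ⟨n / 2, by omega⟩
    · rw [hcoeff _ (by omega), hcoeff _ (by omega),
        show 2 * m - (2 * m / 2 - 1) = m + 1 by omega,
        show 2 * m - (2 * m - 2 * m / 2) = m by omega, div_le_one (hpos _ (by omega))]
      exact (mul_self_le_mul_self_iff (hpos _ (by omega)).le (hpos _ (by omega)).le).2 (hdown m m (by omega))
    · rw [hcoeff _ (by omega), hcoeff _ (by omega),
        show 2 * m + 1 - ((2 * m + 1) / 2 - 1) = m + 2 by omega,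
        show 2 * m + 1 - (2 * m + 1 - (2 * m + 1) / 2) = m by omega,
        div_le_one (hpos _ (by omega))]
      have h := hdown m (m + 1) (by omega)
      rw [mul_comm ((f _).coeff m)] at h
      exact le_of_mul_le_mul_left h (hpos _ (by omega))
end

section
/- Let a, b, c be nonnegative integers and let (f_n(x))_{n≥0} be real polynomials with f_0(x) = 1 satisfying f_{n+1}(x) = (a n x + b x + c) f_n(x) + a x (1 - x) f_n'(x) for all n ≥ 0, and suppose deg f_n(x) = n for all n. Then the reciprocal polynomials g_n(x) := x^n f_n(1/x) satisfy g_0(x) = 1 and g_{n+1}(x) = (a n x + b + c x) g_n(x) + a x (1 - x) g_n'(x) for all n ≥ 0. -/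
open Polynomial

namespace Polynomial

theorem reflect_succ_of_natDegree_le {R : Type*} [CommSemiring R] {p : R[X]} {n : ℕ}
    (hp : p.natDegree ≤ n) : reflect (n + 1) p = X * reflect n p := by
  simpa [mul_comm] using reflect_mul p 1 hp (natDegree_one.trans_le zero_le_one)

theorem reflect_succ_X_mul {R : Type*} [CommSemiring R] {p : R[X]} {n : ℕ}
    (hp : p.natDegree ≤ n) : reflect (n + 1) (X * p) = reflect n p := by
  simpa [mul_comm] using reflect_mul p X hp natDegree_X_le

theorem coeff_X_mul_derivative {R : Type*} [CommSemiring R] (p : R[X]) (k : ℕ) :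
    (X * derivative p).coeff k = k * p.coeff k := by
  cases k with
  | zero => simp
  | succ k => rw [coeff_X_mul, coeff_derivative]; push_cast; ring

theorem natDegree_X_mul_derivative_le {R : Type*} [CommSemiring R] (p : R[X]) :
    (X * derivative p).natDegree ≤ p.natDegree := by
  refine natDegree_le_iff_coeff_eq_zero.mpr fun k hk => ?_
  rw [coeff_X_mul_derivative, coeff_eq_zero_of_natDegree_lt hk, mul_zero]

theorem reflect_X_mul_derivative {R : Type*} [CommRing R] {p : R[X]} {n : ℕ}
    (hp : p.natDegree ≤ n) :
    reflect n (X * derivative p) = C (n : R) * reflect n p - X * derivative (reflect n p) := by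
  ext k
  rw [coeff_sub, coeff_C_mul, coeff_X_mul_derivative, coeff_reflect, coeff_reflect,
    coeff_X_mul_derivative]
  rcases le_or_gt k n with hk | hk
  · rw [revAt_le hk, Nat.cast_sub hk]
    ring
  · rw [revAt_eq_self_of_lt hk, coeff_eq_zero_of_natDegree_lt (hp.trans_lt hk)]
    ring

/-- The reflection of the Eulerian-type operator with parameters `a`, `b`, `c` is the operator
with `b` and `c` exchanged, applied to the reflected polynomial. -/
theorem reflect_succ_eulerian {R : Type*} [CommRing R] (a b c : R) {p : R[X]} {n : ℕ}
    (hp : p.natDegree ≤ n) :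
    reflect (n + 1) ((C (a * n + b) * X + C c) * p + C a * X * (1 - X) * derivative p) =
      (C (a * n) * X + C b + C c * X) * reflect n p +
        C a * X * (1 - X) * derivative (reflect n p) := by
  have hd : (X * derivative p).natDegree ≤ n := (natDegree_X_mul_derivative_le p).trans hp
  have expand : (C (a * n + b) * X + C c) * p + C a * X * (1 - X) * derivative p =
      C (a * n + b) * (X * p) + C c * p +
        C a * (X * derivative p - X * (X * derivative p)) := by ring
  rw [expand, reflect_add, reflect_add, reflect_C_mul, reflect_C_mul, reflect_C_mul, reflect_sub,
    reflect_succ_X_mul hp, reflect_succ_X_mul hd, reflect_succ_of_natDegree_le hp,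
    reflect_succ_of_natDegree_le hd, reflect_X_mul_derivative hp]
  simp only [C_add, C_mul]
  ring

end Polynomial

/-- the reciprocal polynomials `g n = X^n * (f n)(1/X)`
(i.e. `Polynomial.reflect n (f n)`) satisfy `g 0 = 1` and the reversed
Eulerian-type recurrence `g (n+1) = (a n X + b + c X) g n + a X (1 - X) (g n)'`. -/
theorem stmt2 (a b c : ℕ)
    (f : ℕ → Polynomial ℝ) (hf0 : f 0 = 1)
    (hrec : ∀ n : ℕ, f (n + 1) =
      (Polynomial.C ((a : ℝ) * n + (b : ℝ)) * Polynomial.X + Polynomial.C (c : ℝ)) * f n +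
        Polynomial.C (a : ℝ) * Polynomial.X * (1 - Polynomial.X) *
          Polynomial.derivative (f n))
    (hdeg : ∀ n : ℕ, (f n).natDegree = n) :
    Polynomial.reflect 0 (f 0) = 1 ∧
    ∀ n : ℕ, Polynomial.reflect (n + 1) (f (n + 1)) =
      (Polynomial.C ((a : ℝ) * n) * Polynomial.X + Polynomial.C (b : ℝ) +
          Polynomial.C (c : ℝ) * Polynomial.X) * Polynomial.reflect n (f n) +
        Polynomial.C (a : ℝ) * Polynomial.X * (1 - Polynomial.X) *
          Polynomial.derivative (Polynomial.reflect n (f n)) := by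
  refine ⟨by simp [hf0], fun n => ?_⟩
  rw [hrec n]
  exact reflect_succ_eulerian (a : ℝ) b c (hdeg n).le
end

section
/- Let a, b, c be nonnegative integers with a + b ≥ c ≥ b > 0, and let (f_n(x))_{n≥0} be real polynomials with f_0(x) = 1 satisfying f_{n+1}(x) = (a n x + b x + c) f_n(x) + a x (1 - x) f_n'(x) for all n ≥ 0, and suppose deg f_n(x) = n for all n. Then for every n ≥ 1 the polynomial f_n(x) is ratio monotone. -/
open Polynomial

/-- The inequality behind both halves of the inductive step. -/
lemma eulerian_core {α β a d s t x x' y y' z : ℝ} (hα : 0 ≤ α) (hβ : 0 ≤ β) (ha : 0 ≤ a)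
    (hd : 0 ≤ d) (hs : 0 < s) (hx' : 0 ≤ x') (hy' : 0 ≤ y') (hz : 0 ≤ z) (hx : x' ≤ x)
    (hy : y' ≤ y) (hts : t ≤ s) (hxy : x * y = s * t) (hxy' : x' * y' = s * z) :
    α * β * s + α * (α + a + d) * x' + β * (β + a + d) * y' + (α + a + d) * (β + a + d) * z ≤
      (α + d) * (β + d) * s + (α + d) * (α + a) * x + (β + d) * (β + a) * y +
        (α + a) * (β + a) * t := by
  have hzt : z ≤ t := by
    refine le_of_mul_le_mul_left ?_ hs
    rw [← hxy, ← hxy']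
    exact mul_le_mul hx hy hy' (hx'.trans hx)
  have hx0 := hx'.trans hx
  have hy0 := hy'.trans hy
  have hamgm : 2 * z ≤ x + y := by
    refine abs_le_of_sq_le_sq' ?_ (by positivity) |>.2
    have : z * z ≤ s * t := mul_le_mul (hzt.trans hts) hzt hz hs.le
    nlinarith [sq_nonneg (x - y)]
  have h1 := mul_le_mul_of_nonneg_left hx (by positivity : 0 ≤ α * (α + a + d))
  have h2 := mul_le_mul_of_nonneg_left hy (by positivity : 0 ≤ β * (β + a + d))
  have h3 := mul_le_mul_of_nonneg_left hzt (by positivity : 0 ≤ (α + a) * (β + a))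
  have h4 := mul_le_mul_of_nonneg_left (hzt.trans hts) (by positivity : 0 ≤ d * (α + β + d))
  have h5 := mul_le_mul_of_nonneg_left hamgm (by positivity : 0 ≤ a * d)
  nlinarith

/-- Multiplicative form of ratio monotonicity of degree `n`, for coefficient sequences shifted by
one place so that `u 0 = 0`. -/
structure ShiftedRatioMonotone (n : ℕ) (u : ℕ → ℝ) : Prop where
  zero : u 0 = 0
  pos : ∀ k ≤ n, 0 < u (k + 1)
  eq_zero : ∀ k, n + 2 ≤ k → u k = 0
  anti : ∀ i j, i + j = n + 1 → u (i + 1) * u (j + 1) ≤ u i * u j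
  mono : ∀ i j, i + j = n → u i * u j ≤ u (i + 1) * u (j + 1)

lemma ShiftedRatioMonotone.nonneg {n : ℕ} {u : ℕ → ℝ} (h : ShiftedRatioMonotone n u) (k : ℕ) :
    0 ≤ u k := by
  rcases k with _ | k
  · exact h.zero.ge
  · rcases le_or_gt k n with hk | hk
    · exact (h.pos k hk).le
    · exact (h.eq_zero _ (by omega)).ge

lemma ShiftedRatioMonotone.step {n : ℕ} {u v : ℕ → ℝ} {a b c : ℝ} (ha : 0 ≤ a) (hb : 0 < b)
    (hbc : b ≤ c) (hca : c ≤ a + b) (h : ShiftedRatioMonotone n u) (hv0 : v 0 = 0)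
    (hv : ∀ k, v (k + 1) = (a * k + c) * u (k + 1) + (a * (n - k + 1) + b) * u k) :
    ShiftedRatioMonotone (n + 1) v := by
  have hc : 0 < c := hb.trans_le hbc
  have hpos : ∀ k ≤ n + 1, 0 < v (k + 1) := by
    intro k hk
    rw [hv]
    have hk' : (0 : ℝ) ≤ n - k + 1 := by
      have : (k : ℝ) ≤ n + 1 := by exact_mod_cast hk
      linarith
    have hu := h.nonneg k
    have hu' := h.nonneg (k + 1)
    rcases Nat.le_or_eq_of_le_succ hk with hk | rfl
    · have := h.pos k hk
      positivity
    · have := h.pos n le_rfl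
      positivity
  have hzero : ∀ k, n + 1 + 2 ≤ k → v k = 0 := by
    intro k hk
    obtain ⟨k, rfl⟩ := Nat.exists_eq_succ_of_ne_zero (by omega : k ≠ 0)
    rw [hv, h.eq_zero k (by omega), h.eq_zero (k + 1) (by omega)]
    simp
  have hnonneg : ∀ k, 0 ≤ v k := by
    rintro (_ | k)
    · exact hv0.ge
    · rcases le_or_gt k (n + 1) with hk | hk
      · exact (hpos k hk).le
      · exact (hzero _ (by omega)).ge
  refine ⟨hv0, hpos, hzero, ?_, ?_⟩
  · rintro (_ | i) (_ | j) hij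
    · omega
    · rw [hzero (j + 1 + 1) (by omega), hv0]; simp
    · rw [hzero (i + 1 + 1) (by omega), hv0]; simp
    · have hn : (n : ℝ) = i + j := by exact_mod_cast (by omega : n = i + j)
      have key := eulerian_core (α := a * i + b) (β := a * j + b) (a := a) (d := c - b)
        (s := u (i + 1) * u (j + 1)) (t := u i * u j) (x := u (i + 1) * u j)
        (x' := u (i + 2) * u (j + 1)) (y := u i * u (j + 1)) (y' := u (i + 1) * u (j + 2))
        (z := u (i + 2) * u (j + 2)) (by positivity) (by positivity) ha (by linarith)
        (mul_pos (h.pos _ (by omega)) (h.pos _ (by omega)))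
        (mul_nonneg (h.nonneg _) (h.nonneg _)) (mul_nonneg (h.nonneg _) (h.nonneg _))
        (mul_nonneg (h.nonneg _) (h.nonneg _)) (h.anti _ _ (by omega)) (h.anti _ _ (by omega))
        (h.mono _ _ (by omega)) (by ring) (by ring)
      rw [hv (i + 1), hv (j + 1), hv i, hv j, hn]
      push_cast
      linarith
  · rintro (_ | i) (_ | j) hij
    · omega
    · rw [hv0, zero_mul]; exact mul_nonneg (hnonneg _) (hnonneg _)
    · rw [hv0, mul_zero]; exact mul_nonneg (hnonneg _) (hnonneg _)
    · have hn : (n : ℝ) = i + j + 1 := by exact_mod_cast (by omega : n = i + j + 1)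
      have key := eulerian_core (α := a * i + c) (β := a * j + c) (a := a) (d := a + b - c)
        (s := u (i + 1) * u (j + 1)) (t := u (i + 2) * u (j + 2)) (x := u (i + 2) * u (j + 1))
        (x' := u (i + 1) * u j) (y := u (i + 1) * u (j + 2)) (y' := u i * u (j + 1))
        (z := u i * u j) (by positivity) (by positivity) ha (by linarith)
        (mul_pos (h.pos _ (by omega)) (h.pos _ (by omega)))
        (mul_nonneg (h.nonneg _) (h.nonneg _)) (mul_nonneg (h.nonneg _) (h.nonneg _))
        (mul_nonneg (h.nonneg _) (h.nonneg _)) (h.mono _ _ (by omega)) (h.mono _ _ (by omega))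
        (h.anti _ _ (by omega)) (by ring) (by ring)
      rw [hv (i + 1), hv (j + 1), hv i, hv j, hn]
      push_cast
      linarith

lemma ShiftedRatioMonotone.ratioMonotone {p : Polynomial ℝ} (hp : 1 ≤ p.natDegree)
    (h : ShiftedRatioMonotone p.natDegree (X * p).coeff) : RatioMonotone p := by
  have hpos : ∀ k ≤ p.natDegree, 0 < p.coeff k := fun k hk => by simpa using h.pos k hk
  have hanti : ∀ i j, i + j + 1 = p.natDegree →
      p.coeff (i + 1) * p.coeff (j + 1) ≤ p.coeff i * p.coeff j := fun i j hij => by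
    simpa using h.anti (i + 1) (j + 1) (by omega)
  have hmono : ∀ i j, i + j + 2 = p.natDegree →
      p.coeff i * p.coeff j ≤ p.coeff (i + 1) * p.coeff (j + 1) := fun i j hij => by
    simpa using h.mono (i + 1) (j + 1) (by omega)
  generalize hn : p.natDegree = n at *
  refine ⟨by rwa [hn], ?_, ?_, ?_, ?_⟩ <;> rw [hn]
  · intro i hi
    rw [div_le_div_iff₀ (hpos _ (by omega)) (hpos _ (by omega))]
    have := hanti i (n - (i + 1)) (by omega)
    rw [show n - (i + 1) + 1 = n - i by omega] at this
    linarith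
  · rw [div_le_one (hpos _ (by omega))]
    obtain ⟨m, rfl | rfl⟩ : ∃ m, n = 2 * m + 1 ∨ n = 2 * m + 2 := ⟨(n - 1) / 2, by omega⟩
    · rw [show (2 * m + 1 - 1) / 2 = m by omega, show 2 * m + 1 - m = m + 1 by omega]
      exact abs_le_of_sq_le_sq' (by linarith [hanti m m (by omega)]) (hpos _ (by omega)).le |>.2
    · rw [show (2 * m + 2 - 1) / 2 = m by omega, show 2 * m + 2 - m = m + 1 + 1 by omega]
      refine le_of_mul_le_mul_left ?_ (hpos (m + 1) (by omega))
      linarith [hanti m (m + 1) (by omega)]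
  · intro i hi
    rw [div_le_div_iff₀ (hpos _ (by omega)) (hpos _ (by omega))]
    have := hmono i (n - 1 - (i + 1)) (by omega)
    rwa [show n - 1 - (i + 1) + 1 = n - 1 - i by omega] at this
  · intro h2
    rw [div_le_one (hpos _ (by omega))]
    obtain ⟨m, rfl | rfl⟩ : ∃ m, n = 2 * m + 2 ∨ n = 2 * m + 3 := ⟨n / 2 - 1, by omega⟩
    · rw [show (2 * m + 2) / 2 - 1 = m by omega, show 2 * m + 2 - (2 * m + 2) / 2 = m + 1 by omega]
      exact abs_le_of_sq_le_sq' (by linarith [hmono m m (by omega)]) (hpos _ (by omega)).le |>.2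
    · rw [show (2 * m + 3) / 2 - 1 = m by omega,
        show 2 * m + 3 - (2 * m + 3) / 2 = m + 1 + 1 by omega]
      refine le_of_mul_le_mul_left ?_ (hpos (m + 1) (by omega))
      linarith [hmono m (m + 1) (by omega)]

lemma coeff_eulerian_succ (a b c : ℝ) (n k : ℕ) (p : Polynomial ℝ) :
    (X * ((C (a * n + b) * X + C c) * p + C a * X * (1 - X) * derivative p)).coeff (k + 1) =
      (a * k + c) * (X * p).coeff (k + 1) + (a * (n - k + 1) + b) * (X * p).coeff k := by
  rw [show (C (a * n + b) * X + C c) * p + C a * X * (1 - X) * derivative p =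
    C (a * n + b) * (X * p) + C c * p + C a * (X * derivative p) -
      C a * (X * (X * derivative p)) by ring]
  rcases k with _ | _ | k <;>
    simp only [coeff_X_mul, coeff_X_mul_zero, coeff_sub, coeff_add, coeff_C_mul,
      coeff_derivative] <;> push_cast <;> ring

/-- under the Eulerian-type recurrence with `a + b ≥ c ≥ b > 0`,
`f n` is ratio monotone for every `n ≥ 1`. -/
theorem stmt3 (a b c : ℕ) (hb : 0 < b) (hbc : b ≤ c) (hca : c ≤ a + b)
    (f : ℕ → Polynomial ℝ) (hf0 : f 0 = 1)
    (hrec : ∀ n : ℕ, f (n + 1) =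
      (Polynomial.C ((a : ℝ) * n + (b : ℝ)) * Polynomial.X + Polynomial.C (c : ℝ)) * f n +
        Polynomial.C (a : ℝ) * Polynomial.X * (1 - Polynomial.X) *
          Polynomial.derivative (f n))
    (hdeg : ∀ n : ℕ, (f n).natDegree = n) :
    ∀ n : ℕ, 1 ≤ n → RatioMonotone (f n) := by
  have ha : (0 : ℝ) ≤ a := a.cast_nonneg
  have hb' : (0 : ℝ) < b := by exact_mod_cast hb
  have hbc' : (b : ℝ) ≤ c := by exact_mod_cast hbc
  have hca' : (c : ℝ) ≤ a + b := by exact_mod_cast hca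
  have key : ∀ n, ShiftedRatioMonotone n (X * f n).coeff := by
    intro n
    induction n with
    | zero =>
      rw [hf0, mul_one]
      refine ⟨by simp, fun k hk => ?_, fun k hk => ?_, fun i j hij => ?_, fun i j hij => ?_⟩
      · simp [Nat.le_zero.1 hk]
      · exact coeff_X_of_ne_one (by omega)
      · obtain ⟨rfl, rfl⟩ | ⟨rfl, rfl⟩ : i = 0 ∧ j = 1 ∨ i = 1 ∧ j = 0 := by omega
        all_goals simp [coeff_X]
      · obtain ⟨rfl, rfl⟩ : i = 0 ∧ j = 0 := by omega
        simp
    | succ n ih =>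
      refine ih.step ha hb' hbc' hca' (by simp) fun k => ?_
      rw [hrec, coeff_eulerian_succ]
  intro n hn
  refine ShiftedRatioMonotone.ratioMonotone (by rwa [hdeg]) ?_
  rw [hdeg]
  exact key n
end

section
/- Let a, b, c be nonnegative integers and let (f_n(x))_{n≥0} be real polynomials with f_0(x) = 1 satisfying f_{n+1}(x) = (a n x + b x + c) f_n(x) + a x (1 - x) f_n'(x) for all n ≥ 0, and suppose deg f_n(x) = n for all n. Define a_n(x) = (f_n(x) − x^{n+1} f_n(1/x))/(1 − x) and b_n(x) = (x^n f_n(1/x) − f_n(x))/(1 − x). Then a_0(x) = 1, b_0(x) = 0, and for all n ≥ 0: a_{n+1}(x) = (a n x + c + c x) a_n(x) + a x (1 − x) a_n'(x) + (a − b + c) x b_n(x), and b_{n+1}(x) = (a n x − a x + b x + b) b_n(x) + a x (1 − x) b_n'(x) + (b − c) a_n(x). -/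
open Polynomial

/-- Reversing coefficients in degree `n + 1` turns the first-order operator
`p ↦ ((a n + b) X + c) p + a X (1 - X) p'` into
`q ↦ (b + (a n + c) X) q + a X (1 - X) q'`. -/
theorem Polynomial.reflect_succ_eulerian_operator {R : Type*} [CommRing R] (a b c : R) (n : ℕ)
    (p : R[X]) (hp : p.natDegree ≤ n) :
    reflect (n + 1) ((C (a * n + b) * X + C c) * p + C a * X * (1 - X) * derivative p) =
      (C b + C (a * n + c) * X) * reflect n p +
        C a * X * (1 - X) * derivative (reflect n p) := by
  refine induction_with_natDegree_le (fun p =>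
    reflect (n + 1) ((C (a * n + b) * X + C c) * p + C a * X * (1 - X) * derivative p) =
      (C b + C (a * n + c) * X) * reflect n p + C a * X * (1 - X) * derivative (reflect n p))
    n (by simp) (fun k r _ hk => ?_) (fun p q _ _ hp hq => ?_) p hp
  · obtain ⟨m, rfl⟩ := Nat.exists_eq_add_of_le hk
    have hX (j : ℕ) : X * (C r * derivative ((X : R[X]) ^ j)) = C (r * j) * X ^ j := by
      cases j with
      | zero => simp
      | succ j =>
        rw [derivative_X_pow, Nat.add_sub_cancel, pow_succ]
        simp only [map_mul]
        ring
    have hsplit : (C (a * ((k + m : ℕ) : R) + b) * X + C c) * (C r * X ^ k) +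
        C a * X * (1 - X) * derivative (C r * X ^ k) =
        C ((a * m + b) * r) * X ^ (k + 1) + C ((c + a * k) * r) * X ^ k := by
      rw [derivative_C_mul]
      simp only [map_add, map_mul, Nat.cast_add] at hX ⊢
      linear_combination C a * (1 - X) * hX k
    rw [hsplit, reflect_add, reflect_C_mul_X_pow, reflect_C_mul_X_pow, reflect_C_mul_X_pow,
      revAt_le (by lia), revAt_le (by lia), revAt_le (by lia),
      show k + m + 1 - (k + 1) = m by lia, show k + m + 1 - k = m + 1 by lia,
      show k + m - k = m by lia, derivative_C_mul]
    simp only [map_add, map_mul, Nat.cast_add] at hX ⊢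
    linear_combination -C a * (1 - X) * hX m
  · simp only [reflect_add, derivative_add, mul_add] at hp hq ⊢
    linear_combination hp + hq

/-- the symmetric-decomposition parts
`A n = (f n − X^(n+1) (f n)(1/X))/(1 − X)` and
`B n = (X^n (f n)(1/X) − f n)/(1 − X)` (here `X^n (f n)(1/X) = reflect n (f n)`,
and division by `1 - X` is expressed by multiplication) satisfy `A 0 = 1`,
`B 0 = 0` and the stated recurrence system. -/
theorem stmt7 (a b c : ℕ)
    (f : ℕ → Polynomial ℝ) (hf0 : f 0 = 1)
    (hrec : ∀ n : ℕ, f (n + 1) =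
      (Polynomial.C ((a : ℝ) * n + (b : ℝ)) * Polynomial.X + Polynomial.C (c : ℝ)) * f n +
        Polynomial.C (a : ℝ) * Polynomial.X * (1 - Polynomial.X) *
          Polynomial.derivative (f n))
    (hdeg : ∀ n : ℕ, (f n).natDegree = n)
    (A B : ℕ → Polynomial ℝ)
    (hA : ∀ n : ℕ, (1 - Polynomial.X) * A n =
      f n - Polynomial.X * Polynomial.reflect n (f n))
    (hB : ∀ n : ℕ, (1 - Polynomial.X) * B n =
      Polynomial.reflect n (f n) - f n) :
    A 0 = 1 ∧ B 0 = 0 ∧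
    (∀ n : ℕ, A (n + 1) =
      (Polynomial.C ((a : ℝ) * n) * Polynomial.X + Polynomial.C (c : ℝ) +
          Polynomial.C (c : ℝ) * Polynomial.X) * A n +
        Polynomial.C (a : ℝ) * Polynomial.X * (1 - Polynomial.X) *
          Polynomial.derivative (A n) +
        Polynomial.C ((a : ℝ) - (b : ℝ) + (c : ℝ)) * Polynomial.X * B n) ∧
    (∀ n : ℕ, B (n + 1) =
      (Polynomial.C ((a : ℝ) * n - (a : ℝ) + (b : ℝ)) * Polynomial.X +
          Polynomial.C (b : ℝ)) * B n +
        Polynomial.C (a : ℝ) * Polynomial.X * (1 - Polynomial.X) *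
          Polynomial.derivative (B n) +
        Polynomial.C ((b : ℝ) - (c : ℝ)) * A n) := by
  have h1X : (1 - X : ℝ[X]) ≠ 0 := by
    intro h
    simpa using congrArg (eval 0) h
  have hg : ∀ n, reflect n (f n) = A n + B n := fun n =>
    mul_left_cancel₀ h1X (by linear_combination -hA n - hB n)
  have hf : ∀ n, f n = A n + X * B n := fun n =>
    mul_left_cancel₀ h1X (by linear_combination -hA n - X * hB n)
  have hreflect : ∀ n, A (n + 1) + B (n + 1) =
      (C (b : ℝ) + C ((a : ℝ) * n + c) * X) * (A n + B n) +
        C (a : ℝ) * X * (1 - X) * derivative (A n + B n) := fun n => by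
    rw [← hg (n + 1), ← hg n, hrec n, reflect_succ_eulerian_operator _ _ _ _ _ (hdeg n).le]
  have hB0 : B 0 = 0 := mul_left_cancel₀ h1X (by simp [hB, hf0])
  have hBsucc : ∀ n : ℕ, B (n + 1) =
      (C ((a : ℝ) * n - (a : ℝ) + (b : ℝ)) * X + C (b : ℝ)) * B n +
        C (a : ℝ) * X * (1 - X) * derivative (B n) + C ((b : ℝ) - (c : ℝ)) * A n := fun n => by
    have hr := hrec n
    have hs := hreflect n
    rw [hf (n + 1), hf n] at hr
    refine mul_left_cancel₀ h1X ?_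
    simp only [derivative_mul, derivative_X, map_add, map_sub, map_mul]
      at hr hs ⊢
    linear_combination hs - hr
  refine ⟨by simpa [hB0, hf0] using (hf 0).symm, hB0, fun n => ?_, hBsucc⟩
  have hs := hreflect n
  rw [hBsucc n] at hs
  simp only [map_add, map_sub, map_mul] at hs ⊢
  linear_combination hs
end

section
/- Suppose a_1, a_2, a_3, a_4, a_5, a_6 are positive real numbers satisfying a_1/a_2 ≤ a_3/a_4 ≤ a_5/a_6, a_2/a_3 ≤ a_4/a_5, a_3 ≤ a_5 and a_4 ≤ a_6, and let λ, λ_1, λ_2, μ be real numbers with 0 < λ_2 ≤ λ_1 ≤ λ and μ ≥ 0. Then (λ_1 a_1 + (λ − λ_1) a_3)/(λ_2 a_2 + (λ − λ_2) a_4) ≤ (λ_1 a_3 + (λ − λ_1) a_5 + μ(a_5 − a_3))/(λ_2 a_4 + (λ − λ_2) a_6 + μ(a_6 − a_4)). -/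
/-- Lemma 2.2: the key ratio inequality with the extra `μ` terms. -/
theorem stmt8 (a1 a2 a3 a4 a5 a6 l l1 l2 m : ℝ)
    (h1 : 0 < a1) (h2 : 0 < a2) (h3 : 0 < a3) (h4 : 0 < a4) (h5 : 0 < a5) (h6 : 0 < a6)
    (h12 : a1 / a2 ≤ a3 / a4) (h34 : a3 / a4 ≤ a5 / a6) (h23 : a2 / a3 ≤ a4 / a5)
    (h35 : a3 ≤ a5) (h46 : a4 ≤ a6)
    (hl2 : 0 < l2) (hl21 : l2 ≤ l1) (hl1 : l1 ≤ l) (hm : 0 ≤ m) :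
    (l1 * a1 + (l - l1) * a3) / (l2 * a2 + (l - l2) * a4) ≤
      (l1 * a3 + (l - l1) * a5 + m * (a5 - a3)) /
        (l2 * a4 + (l - l2) * a6 + m * (a6 - a4)) := by
  rw [div_le_div_iff₀ h2 h4] at h12
  rw [div_le_div_iff₀ h4 h6] at h34
  rw [div_le_div_iff₀ h3 h5] at h23
  have h24 : a2 ≤ a4 := by
    refine le_of_mul_le_mul_right ?_ h5
    nlinarith
  have h13 : a1 ≤ a3 := by
    refine le_of_mul_le_mul_right ?_ h4
    nlinarith
  have h16 : a1 * a6 ≤ a2 * a5 := by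
    refine le_of_mul_le_mul_right ?_ (mul_pos h3 h4)
    calc a1 * a6 * (a3 * a4) = (a1 * a4) * (a3 * a6) := by ring
      _ ≤ (a3 * a2) * (a5 * a4) := by gcongr
      _ = a2 * a5 * (a3 * a4) := by ring
  have hd3 : a3 * (a6 - a4) ≤ a4 * (a5 - a3) := by linarith
  have hd1 : a1 * (a6 - a4) ≤ a2 * (a5 - a3) := by
    refine le_of_mul_le_mul_right ?_ (mul_pos h3 h4)
    calc a1 * (a6 - a4) * (a3 * a4) = (a1 * a4) * (a3 * (a6 - a4)) := by ring
      _ ≤ (a3 * a2) * (a4 * (a5 - a3)) := by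
        have := sub_nonneg.2 h46
        gcongr
      _ = a2 * (a5 - a3) * (a3 * a4) := by ring
  have hd13 : a1 * (a6 - a4) ≤ a4 * (a5 - a3) :=
    (mul_le_mul_of_nonneg_right h13 (sub_nonneg.2 h46)).trans hd3
  obtain ⟨p, rfl⟩ : ∃ p, l = l1 + p := ⟨l - l1, by ring⟩
  obtain ⟨d, rfl⟩ : ∃ d, l1 = l2 + d := ⟨l1 - l2, by ring⟩
  have hp : 0 ≤ p := by linarith
  have hd : 0 ≤ d := by linarith
  have hB : 0 < l2 * a2 + (l2 + d + p - l2) * a4 := by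
    have : 0 ≤ l2 + d + p - l2 := by linarith
    positivity
  have hD : 0 < l2 * a4 + (l2 + d + p - l2) * a6 + m * (a6 - a4) := by
    have : 0 ≤ l2 + d + p - l2 := by linarith
    have := sub_nonneg.2 h46
    positivity
  rw [div_le_div_iff₀ hB hD]
  have e1 := mul_nonneg (mul_nonneg (add_nonneg hl2.le hd) hl2.le) (sub_nonneg.2 h12)
  have e2 := mul_nonneg (mul_nonneg hp (add_nonneg hd hp)) (sub_nonneg.2 h34)
  have e3 := mul_nonneg (mul_nonneg hp hl2.le) (sub_nonneg.2 h16)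
  have e4 : 0 ≤ (l2 * d + d * (d + p)) * (a3 * a4 - a1 * a6) :=
    mul_nonneg (by positivity) (by linarith)
  have f1 := mul_nonneg (mul_nonneg hm hl2.le) (sub_nonneg.2 hd1)
  have f2 := mul_nonneg (mul_nonneg hm hd) (sub_nonneg.2 hd13)
  have f3 := mul_nonneg (mul_nonneg hm hp) (sub_nonneg.2 hd3)
  linarith
end

section
/- Suppose a_1, a_2, a_3, a_4, a_5, a_6 are positive real numbers satisfying a_1/a_2 ≤ a_3/a_4 ≤ a_5/a_6 and a_2/a_3 ≤ a_4/a_5, and let λ, λ_1, λ_2 be real numbers with 0 < λ_2 ≤ λ_1 ≤ λ. Then (λ_1 a_1 + (λ − λ_1) a_3)/(λ_2 a_2 + (λ − λ_2) a_4) ≤ (λ_1 a_3 + (λ − λ_1) a_5)/(λ_2 a_4 + (λ − λ_2) a_6). -/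
/-- the ratio inequality without the `μ` terms. -/
theorem stmt10 (a1 a2 a3 a4 a5 a6 l l1 l2 : ℝ)
    (h1 : 0 < a1) (h2 : 0 < a2) (h3 : 0 < a3) (h4 : 0 < a4) (h5 : 0 < a5) (h6 : 0 < a6)
    (h12 : a1 / a2 ≤ a3 / a4) (h34 : a3 / a4 ≤ a5 / a6) (h23 : a2 / a3 ≤ a4 / a5)
    (hl2 : 0 < l2) (hl21 : l2 ≤ l1) (hl1 : l1 ≤ l) :
    (l1 * a1 + (l - l1) * a3) / (l2 * a2 + (l - l2) * a4) ≤
      (l1 * a3 + (l - l1) * a5) / (l2 * a4 + (l - l2) * a6) := by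
  rw [div_le_div_iff₀ h2 h4] at h12
  rw [div_le_div_iff₀ h4 h6] at h34
  rw [div_le_div_iff₀ h3 h5] at h23
  have hp : 0 ≤ l - l1 := sub_nonneg.2 hl1
  have hq : 0 ≤ l - l2 := by linarith
  have hx : 0 < l1 := hl2.trans_le hl21
  have h16 : a1 * a6 ≤ a2 * a5 := by
    have h := mul_le_mul h12 h34 (by positivity) (by positivity)
    refine le_of_mul_le_mul_right ?_ (mul_pos h3 h4)
    linarith
  have hw : l2 * (l - l1) ≤ l1 * (l - l2) :=
    mul_le_mul hl21 (by linarith) hp hx.le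
  rw [div_le_div_iff₀ (by positivity) (by positivity)]
  have e1 := mul_nonneg (mul_nonneg hx.le hl2.le) (sub_nonneg.2 h12)
  have e2 := mul_nonneg (mul_nonneg hq hp) (sub_nonneg.2 h34)
  have e3 := mul_nonneg (mul_nonneg hx.le hq) (sub_nonneg.2 h16)
  have e4 := mul_nonneg (sub_nonneg.2 hw) (sub_nonneg.2 h23)
  linarith
end

section
/- Let q be a real number with 0 < q ≤ 1 and let (A_n(x,q))_{n≥1} be the q-Eulerian polynomials, defined by A_1(x,q) = q and A_{n+2}(x,q) = (n x + x + q) A_{n+1}(x,q) + x(1 − x) ∂_x A_{n+1}(x,q) for n ≥ 0, so that deg_x A_n(x,q) = n − 1. Then for every n ≥ 1 the polynomial A_n(x,q) (as a polynomial in x of degree n − 1) is bi-gamma-positive. -/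
open Polynomial

/-- The polynomials with a nonnegative expansion in the `X ^ k * (1 + X) ^ l`, `2 * k + l = m`. -/
noncomputable def gammaCone (m : ℕ) : AddSubmonoid ℝ[X] :=
  AddSubmonoid.closure {p | ∃ (c : ℝ) (k l : ℕ), 0 ≤ c ∧ 2 * k + l = m ∧
    p = C c * X ^ k * (1 + X) ^ l}

/-- The operator `p ↦ m x p + x (1 - x) p'`, which raises the center of symmetry. -/
noncomputable def eulerianOp (m : ℕ) (p : ℝ[X]) : ℝ[X] :=
  C (m : ℝ) * X * p + X * (1 - X) * derivative p

theorem term_mem_gammaCone {c : ℝ} (hc : 0 ≤ c) {k l m : ℕ} (h : 2 * k + l = m) :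
    C c * X ^ k * (1 + X) ^ l ∈ gammaCone m :=
  AddSubmonoid.subset_closure ⟨c, k, l, hc, h, rfl⟩

theorem C_mul_mem_gammaCone {m : ℕ} {p : ℝ[X]} (hp : p ∈ gammaCone m) {c : ℝ} (hc : 0 ≤ c) :
    C c * p ∈ gammaCone m := by
  induction hp using AddSubmonoid.closure_induction with
  | mem p hp =>
    obtain ⟨d, k, l, hd, h, rfl⟩ := hp
    convert term_mem_gammaCone (mul_nonneg hc hd) h using 1
    rw [C_mul]
    ring
  | zero => simp
  | add p r _ _ hp hr => simpa [mul_add] using add_mem hp hr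

theorem X_mul_mem_gammaCone {m : ℕ} {p : ℝ[X]} (hp : p ∈ gammaCone m) :
    X * p ∈ gammaCone (m + 2) := by
  induction hp using AddSubmonoid.closure_induction with
  | mem p hp =>
    obtain ⟨d, k, l, hd, h, rfl⟩ := hp
    convert term_mem_gammaCone hd (show 2 * (k + 1) + l = m + 2 by lia) using 1
    ring
  | zero => simp
  | add p r _ _ hp hr => simpa [mul_add] using add_mem hp hr

theorem one_add_X_mul_mem_gammaCone {m : ℕ} {p : ℝ[X]} (hp : p ∈ gammaCone m) :
    (1 + X) * p ∈ gammaCone (m + 1) := by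
  induction hp using AddSubmonoid.closure_induction with
  | mem p hp =>
    obtain ⟨d, k, l, hd, h, rfl⟩ := hp
    convert term_mem_gammaCone hd (show 2 * k + (l + 1) = m + 1 by lia) using 1
    ring
  | zero => simp
  | add p r _ _ hp hr => simpa only [mul_add (1 + X : ℝ[X])] using add_mem hp hr

theorem X_mul_derivative_X_pow (k : ℕ) :
    X * derivative (X ^ k : ℝ[X]) = C (k : ℝ) * X ^ k := by
  cases k with
  | zero => simp
  | succ k =>
    rw [derivative_X_pow]
    simp only [Nat.add_sub_cancel]
    ring

theorem eulerianOp_term (c : ℝ) (k l : ℕ) :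
    eulerianOp (2 * k + l) (C c * X ^ k * (1 + X) ^ l) =
      C (c * k) * X ^ k * (1 + X) ^ (l + 1) +
        C (c * (2 * l)) * X ^ (k + 1) * (1 + X) ^ (l - 1) := by
  have hX := X_mul_derivative_X_pow k
  rw [eulerianOp, derivative_mul, derivative_C_mul]
  cases l with
  | zero =>
    simp only [C_mul, C_add, Nat.cast_add, Nat.cast_mul, Nat.cast_zero, Nat.cast_ofNat, C_0,
      pow_zero, derivative_one, map_ofNat]
    linear_combination C c * (1 - X) * hX
  | succ l =>
    have hd : derivative ((1 + X : ℝ[X]) ^ (l + 1)) = (C (l : ℝ) + 1) * (1 + X) ^ l := by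
      rw [derivative_pow_succ]
      simp
    simp only [hd, C_mul, C_add, Nat.cast_add, Nat.cast_mul, Nat.cast_one, Nat.cast_ofNat, C_1,
      Nat.add_sub_cancel, map_ofNat]
    linear_combination C c * (1 - X) * (1 + X) ^ (l + 1) * hX

theorem eulerianOp_mem_gammaCone {m : ℕ} {p : ℝ[X]} (hp : p ∈ gammaCone m) :
    eulerianOp m p ∈ gammaCone (m + 1) := by
  induction hp using AddSubmonoid.closure_induction with
  | mem p hp =>
    obtain ⟨c, k, l, hc, rfl, rfl⟩ := hp
    rw [eulerianOp_term]
    refine add_mem (term_mem_gammaCone (by positivity) (by lia)) ?_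
    cases l with
    | zero => simp
    | succ l => exact term_mem_gammaCone (by positivity) (by lia)
  | zero => simp [eulerianOp]
  | add p r _ _ hp hr =>
    convert add_mem hp hr using 1
    simp only [eulerianOp, derivative_add]
    ring

theorem natDegree_le_of_mem_gammaCone {m : ℕ} {p : ℝ[X]} (hp : p ∈ gammaCone m) :
    p.natDegree ≤ m := by
  induction hp using AddSubmonoid.closure_induction with
  | mem p hp =>
    obtain ⟨c, k, l, hc, rfl, rfl⟩ := hp
    have : (C c * X ^ k * (1 + X) ^ l : ℝ[X]).natDegree ≤ k + l := by compute_degree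
    lia
  | zero => simp
  | add p r _ _ hp hr => exact natDegree_add_le_of_degree_le hp hr

theorem reflect_of_mem_gammaCone {m : ℕ} {p : ℝ[X]} (hp : p ∈ gammaCone m) :
    reflect m p = p := by
  induction hp using AddSubmonoid.closure_induction with
  | mem p hp =>
    obtain ⟨c, k, l, hc, rfl, rfl⟩ := hp
    have hl : reflect l ((1 + X : ℝ[X]) ^ l) = (1 + X) ^ l := by
      induction l with
      | zero => simp
      | succ l ih =>
        rw [pow_succ, reflect_mul _ _ (by compute_degree) (by compute_degree), ih, reflect_add,
          ← C_1, reflect_C, reflect_one_X]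
        simp [add_comm]
    have hk : reflect (2 * k) (C c * X ^ k : ℝ[X]) = C c * X ^ k := by
      rw [reflect_C_mul_X_pow, revAt_le (by lia)]
      congr 2
      lia
    rw [reflect_mul _ _ _ (by compute_degree), hl, hk]
    have : (C c * X ^ k : ℝ[X]).natDegree ≤ k := by compute_degree
    lia
  | zero => simp
  | add p r _ _ hp hr => rw [reflect_add, hp, hr]

theorem exists_gamma_of_mem_gammaCone {m : ℕ} {p : ℝ[X]} (hp : p ∈ gammaCone m) :
    ∃ γ : ℕ → ℝ, (∀ k, 0 ≤ γ k) ∧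
      p = ∑ k ∈ Finset.range (m / 2 + 1), C (γ k) * X ^ k * (1 + X) ^ (m - 2 * k) := by
  induction hp using AddSubmonoid.closure_induction with
  | mem p hp =>
    obtain ⟨c, k, l, hc, rfl, rfl⟩ := hp
    refine ⟨Pi.single k c, fun j => ?_, ?_⟩
    · exact (Pi.single_nonneg.2 hc : (0 : ℕ → ℝ) ≤ Pi.single k c) j
    · rw [Finset.sum_eq_single k]
      · simp
      · intro j _ hj
        simp [hj]
      · intro h
        exact absurd (Finset.mem_range.2 (by lia)) h
  | zero => exact ⟨0, fun _ => le_rfl, by simp⟩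
  | add p r _ _ hp hr =>
    obtain ⟨γ, hγ, hpγ⟩ := hp
    obtain ⟨δ, hδ, hrδ⟩ := hr
    refine ⟨γ + δ, fun k => add_nonneg (hγ k) (hδ k), ?_⟩
    rw [hpγ, hrδ, ← Finset.sum_add_distrib]
    refine Finset.sum_congr rfl fun k _ => ?_
    rw [Pi.add_apply, C_add]
    ring

theorem gammaPositive_of_mem_gammaCone {m : ℕ} {p : ℝ[X]} (hp : p ∈ gammaCone m)
    (h0 : p.coeff 0 ≠ 0) : GammaPositive p := by
  have hm : p.natDegree = m := by
    refine natDegree_eq_of_le_of_coeff_ne_zero (natDegree_le_of_mem_gammaCone hp) ?_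
    rw [← reflect_of_mem_gammaCone hp, coeff_reflect, revAt_le le_rfl, Nat.sub_self]
    exact h0
  rw [GammaPositive, hm]
  exact exists_gamma_of_mem_gammaCone hp

theorem biGammaPositive_add_X_mul {n : ℕ} {a b : ℝ[X]} (ha : a ∈ gammaCone (n + 1))
    (hb : b ∈ gammaCone n) (ha0 : a.coeff 0 ≠ 0) (hb0 : b = 0 ∨ b.coeff 0 ≠ 0)
    (hdeg : (a + X * b).natDegree = n + 1) : BiGammaPositive (a + X * b) := by
  have hr : reflect (n + 1) (a + X * b) = a + b := by
    rw [reflect_add, reflect_of_mem_gammaCone ha, mul_comm X b,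
      reflect_mul _ _ (natDegree_le_of_mem_gammaCone hb) natDegree_X_le,
      reflect_of_mem_gammaCone hb, reflect_one_X, mul_one]
  refine ⟨a, b, ?_, ?_, gammaPositive_of_mem_gammaCone ha ha0, ?_⟩
  · rw [hdeg, hr]
    ring
  · rw [hdeg, hr]
    ring
  · rcases hb0 with rfl | hb0
    · exact gammaPositive_zero
    · exact gammaPositive_of_mem_gammaCone hb hb0

theorem qEulerian_decomposition {q : ℝ} (hq0 : 0 < q) (hq1 : q ≤ 1) {A : ℕ → ℝ[X]}
    (hA1 : A 1 = C q)
    (hrec : ∀ n : ℕ, A (n + 2) = (C ((n : ℝ) + 1) * X + C q) * A (n + 1) +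
      X * (1 - X) * derivative (A (n + 1))) (n : ℕ) :
    ∃ a ∈ gammaCone (n + 1), ∃ b ∈ gammaCone n, 0 < a.coeff 0 ∧ (b = 0 ∨ 0 < b.coeff 0) ∧
      A (n + 2) = a + X * b := by
  have hq : 0 ≤ 1 - q := sub_nonneg.2 hq1
  induction n with
  | zero =>
    refine ⟨C (q * q) * X ^ 0 * (1 + X) ^ 1, term_mem_gammaCone (by positivity) rfl,
      C (q * (1 - q)) * X ^ 0 * (1 + X) ^ 0, term_mem_gammaCone (by positivity) rfl, ?_, ?_, ?_⟩
    · simpa [coeff_zero_eq_eval_zero] using hq0.ne'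
    · rcases hq.eq_or_lt with h | h
      · simp [← h]
      · right
        simpa [coeff_zero_eq_eval_zero] using mul_pos hq0 h
    · rw [hrec, hA1]
      simp only [C_mul, C_sub, C_1, C_add, Nat.cast_zero, C_0, derivative_C]
      ring
  | succ n ih =>
    obtain ⟨a, ha, b, hb, ha0, hb0, hA⟩ := ih
    refine ⟨eulerianOp (n + 1) a + C q * ((1 + X) * a) + C q * (X * b), ?_,
      eulerianOp n b + (1 + X) * b + C (1 - q) * a, ?_, ?_, ?_, ?_⟩
    · exact add_mem (add_mem (eulerianOp_mem_gammaCone ha)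
        (C_mul_mem_gammaCone (one_add_X_mul_mem_gammaCone ha) hq0.le))
        (C_mul_mem_gammaCone (X_mul_mem_gammaCone hb) hq0.le)
    · exact add_mem (add_mem (eulerianOp_mem_gammaCone hb) (one_add_X_mul_mem_gammaCone hb))
        (C_mul_mem_gammaCone ha hq)
    · rw [coeff_zero_eq_eval_zero] at ha0 ⊢
      simpa [eulerianOp] using mul_pos hq0 ha0
    · rw [coeff_zero_eq_eval_zero] at ha0 hb0 ⊢
      rcases hb0 with rfl | hb0
      · rcases hq.eq_or_lt with h | h
        · simp [eulerianOp, ← h]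
        · right
          simpa [eulerianOp] using mul_pos h ha0
      · right
        have : 0 < b.eval 0 + (1 - q) * a.eval 0 := by positivity
        simpa [eulerianOp] using this
    · rw [hrec (n + 1), hA]
      simp only [eulerianOp, derivative_add, derivative_mul, derivative_X, C_sub, C_1, C_add,
        Nat.cast_add, Nat.cast_one]
      ring

/-- for `0 < q ≤ 1`, the `(exc, cyc)` `q`-Eulerian polynomials
`A n` (of degree `n - 1` in `x`) are bi-gamma-positive for all `n ≥ 1`. -/
theorem stmt11 (q : ℝ) (hq0 : 0 < q) (hq1 : q ≤ 1)
    (A : ℕ → Polynomial ℝ) (hA1 : A 1 = Polynomial.C q)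
    (hrec : ∀ n : ℕ, A (n + 2) =
      (Polynomial.C ((n : ℝ) + 1) * Polynomial.X + Polynomial.C q) * A (n + 1) +
        Polynomial.X * (1 - Polynomial.X) * Polynomial.derivative (A (n + 1)))
    (hdeg : ∀ n : ℕ, 1 ≤ n → (A n).natDegree = n - 1) :
    ∀ n : ℕ, 1 ≤ n → BiGammaPositive (A n) := by
  intro n hn
  obtain rfl | ⟨n, rfl⟩ : n = 1 ∨ ∃ k, n = k + 2 := by
    rcases n with _ | _ | n
    · lia
    · exact Or.inl rfl
    · exact Or.inr ⟨n, rfl⟩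
  · rw [hA1]
    refine ⟨C q, 0, ?_, ?_, ?_, gammaPositive_zero⟩
    · simp only [natDegree_C, reflect_C, pow_zero, mul_one]
      ring
    · simp
    · exact gammaPositive_of_mem_gammaCone (m := 0)
        (by simpa using term_mem_gammaCone (k := 0) (l := 0) hq0.le rfl) (by simpa using hq0.ne')
  · obtain ⟨a, ha, b, hb, ha0, hb0, hA⟩ := qEulerian_decomposition hq0 hq1 hA1 hrec n
    have hd := hdeg (n + 2) (by lia)
    rw [hA] at hd ⊢
    exact biGammaPositive_add_X_mul ha hb ha0.ne' (hb0.imp_right ne_of_gt) hd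
end

section
/- Let q be a real number with 0 < q ≤ 1 and let (A_n(x,q))_{n≥1} be the q-Eulerian polynomials, defined by A_1(x,q) = q and A_{n+2}(x,q) = (n x + x + q) A_{n+1}(x,q) + x(1 − x) ∂_x A_{n+1}(x,q) for n ≥ 0, so that deg_x A_n(x,q) = n − 1. Then for every n ≥ 2 the reciprocal polynomial x^{n−1} A_n(1/x, q) is ratio monotone. -/
open Polynomial

/-- If `w ≤ x`, `w ≤ y` and `u * v = x * y`, then `2 * w ≤ u + v`. -/
lemma two_mul_le_add_of_mul_eq {u v w x y : ℝ} (hu : 0 ≤ u) (hv : 0 ≤ v) (hw : 0 ≤ w)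
    (hx : w ≤ x) (hy : w ≤ y) (h : u * v = x * y) : 2 * w ≤ u + v := by
  have h1 : w * w ≤ x * y := mul_le_mul hx hy hw (hw.trans hx)
  nlinarith [sq_nonneg (u - v)]

/-- `qEulerianCoeff q d k` is the coefficient of `x ^ k` in the `q`-Eulerian polynomial of
degree `d`, extended by zero to all integers `k`. -/
noncomputable def qEulerianCoeff (q : ℝ) : ℕ → ℤ → ℝ
  | 0, k => if k = 0 then q else 0
  | d + 1, k => (k + q) * qEulerianCoeff q d k + (d + 2 - k) * qEulerianCoeff q d (k - 1)

namespace qEulerianCoeff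

variable {q : ℝ}

lemma eq_zero_of_neg (d : ℕ) : ∀ {k : ℤ}, k < 0 → qEulerianCoeff q d k = 0 := by
  induction d with
  | zero => intro k hk; simp [qEulerianCoeff, hk.ne]
  | succ d ih =>
    intro k hk
    simp [qEulerianCoeff, ih hk, ih (show k - 1 < 0 by omega)]

lemma eq_zero_of_lt (d : ℕ) : ∀ {k : ℤ}, (d : ℤ) < k → qEulerianCoeff q d k = 0 := by
  induction d with
  | zero => intro k hk; simp only [qEulerianCoeff]; rw [if_neg (by omega)]
  | succ d ih =>
    intro k hk
    push_cast at hk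
    simp [qEulerianCoeff, ih (show (d : ℤ) < k by omega), ih (show (d : ℤ) < k - 1 by omega)]

lemma pos (hq : 0 < q) (d : ℕ) :
    ∀ {k : ℤ}, 0 ≤ k → k ≤ d → 0 < qEulerianCoeff q d k := by
  induction d with
  | zero =>
    intro k hk hkd
    obtain rfl : k = 0 := by omega
    simpa [qEulerianCoeff]
  | succ d ih =>
    intro k hk hkd
    push_cast at hkd
    have hk' : (0 : ℝ) ≤ k := by exact_mod_cast hk
    have hkd' : (k : ℝ) ≤ d + 1 := by exact_mod_cast hkd
    have h1 : 0 < (k : ℝ) + q := by linarith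
    have h2 : 0 < (d : ℝ) + 2 - k := by linarith
    simp only [qEulerianCoeff]
    rcases hk.eq_or_lt with rfl | hk0
    · rw [eq_zero_of_neg d (k := 0 - 1) (by omega), mul_zero, add_zero]
      exact mul_pos h1 (ih le_rfl (by omega))
    · have h3 := mul_pos h2 (ih (show (0 : ℤ) ≤ k - 1 by omega) (by omega))
      rcases hkd.eq_or_lt with hkd1 | hkd1
      · rw [eq_zero_of_lt d (k := k) (by omega), mul_zero, zero_add]
        exact h3
      · exact add_pos (mul_pos h1 (ih hk (by omega))) h3

lemma nonneg (hq : 0 < q) (d : ℕ) (k : ℤ) : 0 ≤ qEulerianCoeff q d k := by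
  rcases lt_or_ge k 0 with h | h
  · exact (eq_zero_of_neg d h).ge
  · rcases lt_or_ge (d : ℤ) k with h' | h'
    · exact (eq_zero_of_lt d h').ge
    · exact (pos hq d h h').le

/-- One step of the recurrence preserves the first family of inequalities; here `a, b, c` and
`a', b', c'` are triples of consecutive coefficients centred at `i` and `j`. -/
lemma step_sum_pred_le {i j a b c a' b' c' : ℝ} (hq : 0 < q) (hq1 : q ≤ 1)
    (hi : 0 ≤ i) (hj : 0 ≤ j) (ha : 0 ≤ a) (hb : 0 < b) (hc : 0 ≤ c)
    (ha' : 0 ≤ a') (hb' : 0 < b') (hc' : 0 ≤ c')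
    (h1 : b * a' ≤ c * b') (h2 : a * b' ≤ b * c') (h3 : c * c' ≤ b * b') :
    ((i + q) * b + (j + 2) * a) * ((j + q) * b' + (i + 2) * a') ≤
      ((i + 1 + q) * c + (j + 1) * b) * ((j + 1 + q) * c' + (i + 1) * b') := by
  have hyw : a * a' ≤ c * c' := by
    refine le_of_mul_le_mul_left ?_ (mul_pos hb hb')
    calc b * b' * (a * a') = (b * a') * (a * b') := by ring
      _ ≤ (c * b') * (b * c') := by gcongr
      _ = b * b' * (c * c') := by ring
  have h2y : 2 * (a * a') ≤ c * b' + b * c' :=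
    two_mul_le_add_of_mul_eq (by positivity) (by positivity) (by positivity)
      (hyw.trans h3) hyw (by ring)
  have e0 : 0 ≤ (1 - q) * ((i + j + 1 + q) * (b * b' - a * a')) :=
    mul_nonneg (by linarith) (mul_nonneg (by positivity) (by linarith))
  have e1 : 0 ≤ (1 - q) * (c * b' + b * c' - 2 * (a * a')) :=
    mul_nonneg (by linarith) (by linarith)
  have e2 : 0 ≤ (i + q) * (i + 2) * (c * b' - b * a') :=
    mul_nonneg (by positivity) (by linarith)
  have e3 : 0 ≤ (j + 2) * (j + q) * (b * c' - a * b') :=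
    mul_nonneg (by positivity) (by linarith)
  have e4 : 0 ≤ (i + 1 + q) * (j + 1 + q) * (c * c' - a * a') :=
    mul_nonneg (by positivity) (by linarith)
  linear_combination e0 + e1 + e2 + e3 + e4

/-- One step of the recurrence preserves the second family of inequalities; here `a, b, c` and
`a', b', c'` are triples of consecutive coefficients centred at `i` and `j`. -/
lemma step_succ_succ_le {i j a b c a' b' c' : ℝ} (hq : 0 < q)
    (hi : 0 ≤ i) (hj : 0 ≤ j) (ha : 0 ≤ a) (hb : 0 < b) (hc : 0 ≤ c)
    (ha' : 0 ≤ a') (hb' : 0 < b') (hc' : 0 ≤ c')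
    (h1 : c * b' ≤ b * a') (h2 : b * c' ≤ a * b') (h3 : a * a' ≤ b * b') :
    ((i + 1 + q) * c + j * b) * ((j + 1 + q) * c' + i * b') ≤
      ((i + q) * b + (j + 1) * a) * ((j + q) * b' + (i + 1) * a') := by
  have hwy : c * c' ≤ a * a' := by
    refine le_of_mul_le_mul_left ?_ (mul_pos hb hb')
    calc b * b' * (c * c') = (c * b') * (b * c') := by ring
      _ ≤ (b * a') * (a * b') := by gcongr
      _ = b * b' * (a * a') := by ring
  have h2w : 2 * (c * c') ≤ b * a' + a * b' :=
    two_mul_le_add_of_mul_eq (by positivity) (by positivity) (by positivity)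
      (hwy.trans h3) hwy (by ring)
  have e0 : 0 ≤ q * (i + j + q) * (b * b' - c * c') :=
    mul_nonneg (by positivity) (by linarith)
  have e1 : 0 ≤ q * (b * a' + a * b' - 2 * (c * c')) :=
    mul_nonneg hq.le (by linarith)
  have e2 : 0 ≤ i * (i + 1 + q) * (b * a' - c * b') :=
    mul_nonneg (by positivity) (by linarith)
  have e3 : 0 ≤ j * (j + 1 + q) * (a * b' - b * c') :=
    mul_nonneg (by positivity) (by linarith)
  have e4 : 0 ≤ (i + 1) * (j + 1) * (a * a' - c * c') :=
    mul_nonneg (by positivity) (by linarith)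
  linear_combination e0 + e1 + e2 + e3 + e4

/-- The two families of inequalities behind ratio monotonicity, in product form. -/
lemma mul_le_mul_and (hq : 0 < q) (hq1 : q ≤ 1) (d : ℕ) :
    (∀ i j : ℤ, i + j + 1 = d →
      qEulerianCoeff q d i * qEulerianCoeff q d j ≤
        qEulerianCoeff q d (i + 1) * qEulerianCoeff q d (j + 1)) ∧
    (∀ i j : ℤ, i + j = d →
      qEulerianCoeff q d (i + 1) * qEulerianCoeff q d (j + 1) ≤
        qEulerianCoeff q d i * qEulerianCoeff q d j) := by
  induction d with
  | zero =>
    refine ⟨fun i j h => ?_, fun i j h => ?_⟩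
    · have hz : qEulerianCoeff q 0 i * qEulerianCoeff q 0 j = 0 := by
        rcases lt_or_ge i 0 with hi | hi
        · rw [eq_zero_of_neg 0 hi, zero_mul]
        · rw [eq_zero_of_neg 0 (k := j) (by omega), mul_zero]
      rw [hz]
      exact mul_nonneg (nonneg hq _ _) (nonneg hq _ _)
    · have hz : qEulerianCoeff q 0 (i + 1) * qEulerianCoeff q 0 (j + 1) = 0 := by
        rcases lt_or_ge i 0 with hi | hi
        · rw [eq_zero_of_lt 0 (k := j + 1) (by omega), mul_zero]
        · rw [eq_zero_of_lt 0 (k := i + 1) (by omega), zero_mul]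
      rw [hz]
      exact mul_nonneg (nonneg hq _ _) (nonneg hq _ _)
  | succ d ih =>
    obtain ⟨hP, hQ⟩ := ih
    refine ⟨fun i j h => ?_, fun i j h => ?_⟩
    · have hr := mul_nonneg (nonneg hq (d + 1) (i + 1)) (nonneg hq (d + 1) (j + 1))
      rcases lt_or_ge i 0 with hi | hi
      · rwa [eq_zero_of_neg (d + 1) hi, zero_mul]
      rcases lt_or_ge j 0 with hj | hj
      · rwa [eq_zero_of_neg (d + 1) hj, mul_zero]
      push_cast at h
      have hd : (d : ℝ) = i + j := by
        have : (d : ℤ) = i + j := by omega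
        exact_mod_cast this
      have h1 := hP i (j - 1) (by omega)
      have h2 := hP (i - 1) j (by omega)
      rw [sub_add_cancel] at h1 h2
      convert step_sum_pred_le hq hq1 (i := (i : ℝ)) (j := (j : ℝ)) (by exact_mod_cast hi)
        (by exact_mod_cast hj) (nonneg hq d (i - 1)) (pos hq d hi (by omega))
        (nonneg hq d (i + 1)) (nonneg hq d (j - 1)) (pos hq d hj (by omega))
        (nonneg hq d (j + 1)) h1 h2 (hQ i j (by omega)) using 1 <;>
      · simp only [qEulerianCoeff, add_sub_cancel_right, hd]
        push_cast
        ring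
    · have hr := mul_nonneg (nonneg hq (d + 1) i) (nonneg hq (d + 1) j)
      push_cast at h
      rcases lt_or_ge i 1 with hi | hi
      · rwa [eq_zero_of_lt (d + 1) (k := j + 1) (by push_cast; omega), mul_zero]
      rcases lt_or_ge j 1 with hj | hj
      · rwa [eq_zero_of_lt (d + 1) (k := i + 1) (by push_cast; omega), zero_mul]
      have hd : (d : ℝ) = i + j - 1 := by
        have : (d : ℤ) = i + j - 1 := by omega
        exact_mod_cast this
      have h1 := hQ i (j - 1) (by omega)
      have h2 := hQ (i - 1) j (by omega)
      have h3 := hP (i - 1) (j - 1) (by omega)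
      rw [sub_add_cancel] at h1 h2
      rw [sub_add_cancel, sub_add_cancel] at h3
      convert step_succ_succ_le hq (i := (i : ℝ)) (j := (j : ℝ))
        (by exact_mod_cast (show (0 : ℤ) ≤ i by omega))
        (by exact_mod_cast (show (0 : ℤ) ≤ j by omega)) (nonneg hq d (i - 1))
        (pos hq d (show (0 : ℤ) ≤ i by omega) (by omega)) (nonneg hq d (i + 1))
        (nonneg hq d (j - 1)) (pos hq d (show (0 : ℤ) ≤ j by omega) (by omega))
        (nonneg hq d (j + 1)) h1 h2 h3 using 1 <;>
      · simp only [qEulerianCoeff, add_sub_cancel_right, hd]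
        push_cast
        ring

end qEulerianCoeff

/-- The coefficients of polynomials satisfying the `q`-Eulerian recurrence. -/
lemma coeff_eq_qEulerianCoeff {q : ℝ} {A : ℕ → Polynomial ℝ} (hA1 : A 1 = Polynomial.C q)
    (hrec : ∀ n : ℕ, A (n + 2) =
      (Polynomial.C ((n : ℝ) + 1) * Polynomial.X + Polynomial.C q) * A (n + 1) +
        Polynomial.X * (1 - Polynomial.X) * Polynomial.derivative (A (n + 1)))
    (d : ℕ) : ∀ k : ℕ, (A (d + 1)).coeff k = qEulerianCoeff q d k := by
  induction d with
  | zero => intro k; simp [hA1, qEulerianCoeff, coeff_C]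
  | succ d ih =>
    intro k
    have hr : A (d + 1 + 1) = C ((d : ℝ) + 1) * (X * A (d + 1)) + C q * A (d + 1) +
        (X * derivative (A (d + 1)) - X * (X * derivative (A (d + 1)))) := by
      rw [hrec d]; ring
    rw [hr]
    rcases k with _ | _ | k
    · simp [ih, qEulerianCoeff, qEulerianCoeff.eq_zero_of_neg]
    · simp only [coeff_add, coeff_sub, coeff_C_mul, coeff_X_mul, coeff_derivative, ih,
        qEulerianCoeff, zero_add, coeff_X_mul_zero]
      push_cast
      ring
    · have hk : (((k + 1 + 1 : ℕ) : ℤ) - 1) = ((k + 1 : ℕ) : ℤ) := by push_cast; ring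
      simp only [coeff_add, coeff_sub, coeff_C_mul, coeff_X_mul, coeff_derivative, ih,
        qEulerianCoeff, hk]
      push_cast
      ring

/-- for `0 < q ≤ 1`, the reciprocal polynomials
`X^(n-1) * (A n)(1/X)` of the `q`-Eulerian polynomials are ratio monotone for `n ≥ 2`. -/
theorem stmt12 (q : ℝ) (hq0 : 0 < q) (hq1 : q ≤ 1)
    (A : ℕ → Polynomial ℝ) (hA1 : A 1 = Polynomial.C q)
    (hrec : ∀ n : ℕ, A (n + 2) =
      (Polynomial.C ((n : ℝ) + 1) * Polynomial.X + Polynomial.C q) * A (n + 1) +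
        Polynomial.X * (1 - Polynomial.X) * Polynomial.derivative (A (n + 1)))
    (hdeg : ∀ n : ℕ, 1 ≤ n → (A n).natDegree = n - 1) :
    ∀ n : ℕ, 2 ≤ n → RatioMonotone (Polynomial.reflect (n - 1) (A n)) := by
  intro n hn
  obtain ⟨d, rfl⟩ : ∃ d, n = d + 1 := ⟨n - 1, by omega⟩
  rw [Nat.add_sub_cancel]
  have hpos : ∀ {k : ℤ}, 0 ≤ k → k ≤ d → 0 < qEulerianCoeff q d k := qEulerianCoeff.pos hq0 d
  obtain ⟨hP, hQ⟩ := qEulerianCoeff.mul_le_mul_and hq0 hq1 d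
  have hc : ∀ k : ℕ, k ≤ d →
      (reflect d (A (d + 1))).coeff k = qEulerianCoeff q d ((d : ℤ) - k) := by
    intro k hk
    rw [coeff_reflect, revAt_le hk, coeff_eq_qEulerianCoeff hA1 hrec, Nat.cast_sub hk]
  have hdeg' : (reflect d (A (d + 1))).natDegree = d := by
    refine natDegree_eq_of_le_of_coeff_ne_zero ?_ ?_
    · refine natDegree_le_iff_coeff_eq_zero.2 fun k hk => ?_
      rw [coeff_reflect, revAt_eq_self_of_lt hk]
      exact coeff_eq_zero_of_natDegree_lt (by rw [hdeg _ (by omega)]; omega)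
    · rw [hc d le_rfl]
      exact (hpos (by omega) (by omega)).ne'
  unfold RatioMonotone
  rw [hdeg']
  refine ⟨fun i hi => ?_, fun i hi => ?_, ?_, fun i hi => ?_, fun h => ?_⟩
  · rw [hc i hi]
    exact hpos (by omega) (by omega)
  · rw [hc _ (by omega), hc _ (by omega), hc _ (by omega), hc _ (by omega),
      div_le_div_iff₀ (hpos (by omega) (by omega)) (hpos (by omega) (by omega))]
    have h1 := hP i ((d : ℤ) - i - 1) (by omega)
    rw [show (d : ℤ) - (d - i : ℕ) = i by omega,
      show (d : ℤ) - (d - (i + 1) : ℕ) = i + 1 by omega,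
      show (d : ℤ) - (i + 1 : ℕ) = d - i - 1 by omega]
    rwa [sub_add_cancel] at h1
  · obtain ⟨m, hm⟩ : ∃ m, m = (d - 1) / 2 := ⟨_, rfl⟩
    rw [← hm, hc _ (by omega), hc _ (by omega), div_le_one (hpos (by omega) (by omega))]
    have h1 := hP m ((d : ℤ) - m - 1) (by omega)
    rw [show (d : ℤ) - (d - m : ℕ) = m by omega]
    rw [show (d : ℤ) - m - 1 + 1 = d - m by ring] at h1
    have hp0 := hpos (k := m) (by omega) (by omega)
    have hp1 := hpos (k := d - m) (by omega) (by omega)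
    rcases Nat.even_or_odd' d with ⟨r, hr | hr⟩
    · rw [show (d : ℤ) - m - 1 = m + 1 by omega, mul_comm] at h1
      exact le_of_mul_le_mul_left h1 (hpos (by omega) (by omega))
    · rw [show (d : ℤ) - m - 1 = m by omega, show (m : ℤ) + 1 = d - m by omega] at h1
      exact le_of_not_gt fun hlt => absurd h1 (not_le.2 (mul_self_lt_mul_self hp1.le hlt))
  · rw [hc _ (by omega), hc _ (by omega), hc _ (by omega), hc _ (by omega),
      div_le_div_iff₀ (hpos (by omega) (by omega)) (hpos (by omega) (by omega))]
    have h1 := hQ ((d : ℤ) - i - 1) (i + 1) (by omega)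
    rw [show (d : ℤ) - (d - 1 - i : ℕ) = i + 1 by omega,
      show (d : ℤ) - (d - 1 - (i + 1) : ℕ) = i + 1 + 1 by omega,
      show (d : ℤ) - (i + 1 : ℕ) = d - i - 1 by omega]
    rwa [sub_add_cancel] at h1
  · obtain ⟨m, hm⟩ : ∃ m, m = d / 2 := ⟨_, rfl⟩
    rw [← hm] at h ⊢
    rw [hc _ (by omega), hc _ (by omega), div_le_one (hpos (by omega) (by omega)),
      show (d : ℤ) - (d - m : ℕ) = m by omega,
      show (d : ℤ) - (m - 1 : ℕ) = d - m + 1 by omega]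
    have h1 := hQ m ((d : ℤ) - m) (by omega)
    rcases Nat.even_or_odd' d with ⟨r, hr | hr⟩
    · have hp0 := hpos (k := m) (by omega) (by omega)
      rw [show (d : ℤ) - m = m by omega] at h1 ⊢
      exact le_of_not_gt fun hlt => absurd h1 (not_le.2 (mul_self_lt_mul_self hp0.le hlt))
    · rw [show (d : ℤ) - m = m + 1 by omega] at h1 ⊢
      rw [mul_comm (qEulerianCoeff q d m)] at h1
      exact le_of_mul_le_mul_left h1 (hpos (by omega) (by omega))
end

section
/- Let k be a positive integer and let (A_n^{(k)}(x))_{n≥0} be the 1/k-Eulerian polynomials, defined by A_0^{(k)}(x) = A_1^{(k)}(x) = 1 and A_{n+2}^{(k)}(x) = (n k x + k x + 1) A_{n+1}^{(k)}(x) + k x (1 − x) (d/dx) A_{n+1}^{(k)}(x) for n ≥ 0, so that deg A_{n+1}^{(k)}(x) = n. Then for every n ≥ 1 the reciprocal polynomial x^n A_{n+1}^{(k)}(1/x) is ratio monotone. -/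
open Polynomial

/-- A doubly infinite sequence supported on `{0, …, n}`, positive there, for which `a_i / a_(n-i)`
and `a_(n+1-i) / a_i` are both nondecreasing in `i` (in cross-multiplied form). -/
structure RatioMonotoneSeq (a : ℤ → ℝ) (n : ℤ) : Prop where
  pos : ∀ i, 0 ≤ i → i ≤ n → 0 < a i
  zero : ∀ i, i < 0 ∨ n < i → a i = 0
  even : ∀ i j, i + j = n → a i * a (j - 1) ≤ a (i + 1) * a j
  odd : ∀ i j, i + j = n → a (j + 1) * a (i + 1) ≤ a i * a j

lemma mul_le_mul_of_cross {p q r P Q R : ℝ} (hR : 0 ≤ R) (hP : 0 ≤ P)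
    (hq : 0 < q) (hQ : 0 < Q) (h₁ : p * Q ≤ q * P) (h₂ : q * R ≤ r * Q) :
    p * R ≤ r * P := by
  have h := mul_le_mul h₁ h₂ (by positivity) (by positivity)
  have hqQ : 0 < q * Q := by positivity
  refine le_of_mul_le_mul_right ?_ hqQ
  linarith

lemma even_cross_step {k i m p q r P Q R : ℝ} (hk : 1 ≤ k) (hi : 0 ≤ i) (hm : 1 ≤ m)
    (hq : 0 ≤ q) (hr : 0 ≤ r) (hP : 0 ≤ P) (hQ : 0 ≤ Q)
    (h₁ : q * R ≤ r * Q) (h₂ : p * Q ≤ q * P) (h₃ : p * R ≤ r * P) (h₄ : r * P ≤ q * Q) :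
    ((1 + k * i) * q + k * (m + 1) * p) * ((1 + k * (m - 1)) * Q + k * (i + 2) * R) ≤
      ((1 + k * (i + 1)) * r + k * m * q) * ((1 + k * m) * P + k * (i + 1) * Q) := by
  have hm' : 0 ≤ m - 1 := by linarith
  have hk' : 0 ≤ k - 1 := by linarith
  have hsq : (r * P) ^ 2 ≤ (r * Q) * (q * P) := by
    nlinarith [mul_le_mul_of_nonneg_left h₄ (mul_nonneg hr hP)]
  have amgm := two_mul_le_add_of_sq_le_mul (mul_nonneg hr hQ) (mul_nonneg hq hP) hsq
  have e₁ := mul_nonneg (show 0 ≤ (1 + k * i) * (k * (i + 2)) by positivity) (sub_nonneg.2 h₁)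
  have e₂ := mul_nonneg (show 0 ≤ k * (m + 1) * (1 + k * (m - 1)) by positivity)
    (sub_nonneg.2 h₂)
  have e₃ := mul_nonneg (show 0 ≤ k * (m + 1) * (k * (i + 2)) by positivity) (sub_nonneg.2 h₃)
  have e₄ := mul_nonneg (show 0 ≤ (k - 1) * (k * (m + i) + 1) by positivity) (sub_nonneg.2 h₄)
  have e₅ := mul_nonneg (show 0 ≤ k * (k - 1) by positivity) (sub_nonneg.2 amgm)
  linarith

lemma odd_cross_step {k i m q r u P Q R : ℝ} (hk : 1 ≤ k) (hi : 0 ≤ i) (hm : 1 ≤ m)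
    (hq : 0 ≤ q) (hr : 0 ≤ r) (hQ : 0 ≤ Q) (hR : 0 ≤ R)
    (h₁ : P * r ≤ Q * q) (h₂ : Q * u ≤ R * r) (h₃ : P * u ≤ q * R) (h₄ : q * R ≤ Q * r) :
    ((1 + k * m) * P + k * (i + 1) * Q) * ((1 + k * (i + 2)) * u + k * (m - 1) * r) ≤
      ((1 + k * (i + 1)) * r + k * m * q) * ((1 + k * (m - 1)) * Q + k * (i + 2) * R) := by
  have hm' : 0 ≤ m - 1 := by linarith
  have hsq : (q * R) ^ 2 ≤ (Q * q) * (R * r) := by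
    nlinarith [mul_le_mul_of_nonneg_left h₄ (mul_nonneg hq hR)]
  have amgm := two_mul_le_add_of_sq_le_mul (mul_nonneg hQ hq) (mul_nonneg hR hr) hsq
  have e₁ := mul_nonneg (show 0 ≤ (1 + k * m) * (k * (m - 1)) by positivity) (sub_nonneg.2 h₁)
  have e₂ := mul_nonneg (show 0 ≤ k * (i + 1) * (1 + k * (i + 2)) by positivity)
    (sub_nonneg.2 h₂)
  have e₃ := mul_nonneg (show 0 ≤ (1 + k * m) * (1 + k * (i + 2)) by positivity)
    (sub_nonneg.2 h₃)
  have e₄ := mul_nonneg (show 0 ≤ k * (m + i) + 1 by positivity) (sub_nonneg.2 h₄)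
  have e₅ := mul_nonneg (show 0 ≤ k by positivity) (sub_nonneg.2 amgm)
  linarith

namespace RatioMonotoneSeq

lemma nonneg {a : ℤ → ℝ} {n : ℤ} (h : RatioMonotoneSeq a n) (i : ℤ) : 0 ≤ a i := by
  by_cases hi : 0 ≤ i ∧ i ≤ n
  · exact (h.pos i hi.1 hi.2).le
  · exact (h.zero i (by omega)).ge

lemma of_recurrence {a b : ℤ → ℝ} {n : ℤ} {k : ℝ} (hk : 1 ≤ k) (hn : 0 ≤ n)
    (h : RatioMonotoneSeq a n)
    (hb : ∀ i : ℤ, b i = (1 + k * i) * a i + k * (n + 2 - i) * a (i - 1)) :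
    RatioMonotoneSeq b (n + 1) := by
  have hpos : ∀ i, 0 ≤ i → i ≤ n + 1 → 0 < b i := by
    intro i hi hin
    have hi' : (0 : ℝ) ≤ i := by exact_mod_cast hi
    have hin' : (i : ℝ) ≤ n + 1 := by exact_mod_cast hin
    have hc : 0 < k * ((n : ℝ) + 2 - i) := mul_pos (by linarith) (by linarith)
    rw [hb]
    rcases hi.eq_or_lt with rfl | hi0
    · have := h.pos 0 le_rfl hn
      have := h.nonneg (0 - 1)
      positivity
    · have := h.pos (i - 1) (by omega) (by omega)
      have := h.nonneg i
      positivity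
  have hzero : ∀ i, i < 0 ∨ n + 1 < i → b i = 0 := by
    intro i hi
    rw [hb, h.zero i (by omega), h.zero (i - 1) (by omega)]
    ring
  have hnonneg : ∀ i, 0 ≤ b i := fun i => by
    by_cases hi : 0 ≤ i ∧ i ≤ n + 1
    · exact (hpos i hi.1 hi.2).le
    · exact (hzero i (by omega)).ge
  refine ⟨hpos, hzero, fun i j hij => ?_, fun i' j hij => ?_⟩
  · obtain rfl : j = n + 1 - i := by omega
    by_cases hi : 0 ≤ i ∧ i ≤ n
    · have hi0 : (0 : ℝ) ≤ i := by exact_mod_cast hi.1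
      have hin : (i : ℝ) ≤ n := by exact_mod_cast hi.2
      have hq := h.pos i hi.1 hi.2
      have hQ := h.pos (n - i) (by omega) (by omega)
      have h₁ := h.even i (n - i) (by ring)
      have h₂ := h.even (i - 1) (n + 1 - i) (by ring)
      have h₄ := h.odd i (n - i) (by ring)
      rw [show n + 1 - i - 1 = n - i by ring, show i - 1 + 1 = i by ring] at h₂
      rw [show n - i + 1 = n + 1 - i by ring, mul_comm] at h₄
      have key := even_cross_step (m := n + 1 - i) hk hi0 (by linarith) hq.le (h.nonneg _)
        (h.nonneg _) hQ.le h₁ h₂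
        (mul_le_mul_of_cross (h.nonneg _) (h.nonneg _) hq hQ h₂ h₁) h₄
      rw [hb, hb, hb, hb]
      convert key using 2 <;> push_cast <;> ring_nf
    · rw [show b i * b (n + 1 - i - 1) = 0 by
        rcases lt_or_ge i 0 with hi' | hi'
        · rw [hzero i (.inl hi'), zero_mul]
        · rw [hzero (n + 1 - i - 1) (by omega), mul_zero]]
      exact mul_nonneg (hnonneg _) (hnonneg _)
  · obtain ⟨i, rfl⟩ : ∃ i, i' = i + 1 := ⟨i' - 1, by ring⟩
    obtain rfl : j = n - i := by omega
    by_cases hi : 0 ≤ i ∧ i + 1 ≤ n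
    · have hi0 : (0 : ℝ) ≤ i := by exact_mod_cast hi.1
      have hin : (i : ℝ) + 1 ≤ n := by exact_mod_cast hi.2
      have hr := h.pos (i + 1) (by omega) hi.2
      have hQ := h.pos (n - i) (by omega) (by omega)
      have h₁ := h.odd i (n - i) (by ring)
      have h₂ := h.odd (i + 1) (n - i - 1) (by ring)
      have h₄ := h.even i (n - i) (by ring)
      rw [show n - i + 1 = n + 1 - i by ring, mul_comm (a i)] at h₁
      rw [show n - i - 1 + 1 = n - i by ring, mul_comm (a (i + 1))] at h₂
      rw [mul_comm (a (i + 1))] at h₄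
      have h₃ := mul_le_mul_of_cross (q := a (n - i)) (Q := a (i + 1))
        (h.nonneg (i + 1 + 1)) (h.nonneg i) hQ hr h₁ h₂
      rw [mul_comm (a (n - i - 1))] at h₃
      have key := odd_cross_step (m := n + 1 - i) hk hi0 (by linarith) (h.nonneg _) hr.le hQ.le
        (h.nonneg _) h₁ h₂ h₃ h₄
      rw [hb, hb, hb, hb]
      convert key using 2 <;> push_cast <;> ring_nf
    · rw [show b (n - i + 1) * b (i + 1 + 1) = 0 by
        rcases lt_or_ge i 0 with hi' | hi'
        · rw [hzero (n - i + 1) (by omega), zero_mul]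
        · rw [hzero (i + 1 + 1) (by omega), mul_zero]]
      exact mul_nonneg (hnonneg _) (hnonneg _)

lemma div_le_div {a : ℤ → ℝ} {n : ℤ} (h : RatioMonotoneSeq a n) {i j : ℤ} (hi : 0 ≤ i)
    (hj : 1 ≤ j) (hij : i + j = n) : a i / a j ≤ a (i + 1) / a (j - 1) := by
  rw [div_le_div_iff₀ (h.pos _ (by omega) (by omega)) (h.pos _ (by omega) (by omega))]
  exact h.even i j hij

lemma div_le_div' {a : ℤ → ℝ} {n : ℤ} (h : RatioMonotoneSeq a n) {i j : ℤ} (hi : 1 ≤ i)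
    (hj : 1 ≤ j) (hij : i + j = n) : a (j + 1) / a i ≤ a j / a (i + 1) := by
  rw [div_le_div_iff₀ (h.pos _ (by omega) (by omega)) (h.pos _ (by omega) (by omega)),
    mul_comm (a j)]
  exact h.odd i j hij

lemma div_le_one {a : ℤ → ℝ} {n : ℤ} (h : RatioMonotoneSeq a n) {i j : ℤ} (hi : 0 ≤ i)
    (hij : i + j = n) (hj : j = i + 1 ∨ j = i + 2) : a i / a j ≤ 1 := by
  have hj0 := h.pos j (by omega) (by omega)
  rw [div_le_one₀ hj0]
  have := h.even i j hij
  rcases hj with rfl | rfl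
  · rw [add_sub_cancel_right] at this
    exact (mul_self_le_mul_self_iff (h.nonneg _) hj0.le).2 this
  · rw [show i + 2 - 1 = i + 1 by ring, mul_comm] at this
    exact le_of_mul_le_mul_left this (h.pos _ (by omega) (by omega))

lemma div_le_one' {a : ℤ → ℝ} {n : ℤ} (h : RatioMonotoneSeq a n) {i j : ℤ} (hi : 1 ≤ i)
    (hij : i + j = n) (hj : j = i ∨ j = i + 1) : a (j + 1) / a i ≤ 1 := by
  have hi0 := h.pos i (by omega) (by omega)
  rw [div_le_one₀ hi0]
  have := h.odd i j hij
  rcases hj with rfl | rfl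
  · exact (mul_self_le_mul_self_iff (h.nonneg _) hi0.le).2 this
  · exact le_of_mul_le_mul_right this (h.pos _ (by omega) (by omega))

end RatioMonotoneSeq

/-- The coefficients of a polynomial, extended by zero to negative indices. -/
noncomputable def Polynomial.intCoeff (p : Polynomial ℝ) (i : ℤ) : ℝ :=
  if 0 ≤ i then p.coeff i.toNat else 0

lemma Polynomial.intCoeff_natCast (p : Polynomial ℝ) (i : ℕ) :
    p.intCoeff i = p.coeff i := by
  simp [Polynomial.intCoeff]

lemma RatioMonotoneSeq.one : RatioMonotoneSeq (1 : Polynomial ℝ).intCoeff 0 := by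
  have h : ∀ i, (1 : Polynomial ℝ).intCoeff i = if i = 0 then 1 else 0 := by
    intro i
    simp only [Polynomial.intCoeff, Polynomial.coeff_one]
    split_ifs <;> first | rfl | omega
  refine ⟨fun i _ _ => ?_, fun i _ => ?_, fun i j _ => ?_, fun i j _ => ?_⟩ <;>
    simp only [h] <;> split_ifs <;> first | omega | norm_num

lemma Polynomial.intCoeff_recurrence (p : Polynomial ℝ) (k n : ℝ) (i : ℤ) :
    ((C (k * n + k) * X + 1) * p + C k * X * (1 - X) * derivative p).intCoeff i =
      (1 + k * i) * p.intCoeff i + k * (n + 2 - i) * p.intCoeff (i - 1) := by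
  have hp : (C (k * n + k) * X + 1) * p + C k * X * (1 - X) * derivative p =
      p + C (k * n + k) * (X * p) + C k * (X * derivative p) -
        C k * (X * (X * derivative p)) := by ring
  rw [hp]
  rcases lt_or_ge i 0 with hi | hi
  · simp [Polynomial.intCoeff, hi.not_ge, show ¬ 1 ≤ i by omega]
  lift i to ℕ using hi
  rcases i with _ | _ | i
  · simp [Polynomial.intCoeff]
  · rw [show ((0 + 1 : ℕ) : ℤ) - 1 = ((0 : ℕ) : ℤ) by simp]
    simp only [Polynomial.intCoeff_natCast, coeff_sub, coeff_add, coeff_C_mul, coeff_X_mul,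
      coeff_derivative, coeff_X_mul_zero]
    push_cast
    ring
  · rw [show ((i + 1 + 1 : ℕ) : ℤ) - 1 = ((i + 1 : ℕ) : ℤ) by push_cast; ring]
    simp only [Polynomial.intCoeff_natCast, coeff_sub, coeff_add, coeff_C_mul, coeff_X_mul,
      coeff_derivative]
    push_cast
    ring

lemma RatioMonotoneSeq.ratioMonotone_reflect {p : Polynomial ℝ} {n : ℕ} (hn : 1 ≤ n)
    (h : RatioMonotoneSeq p.intCoeff n) : RatioMonotone (reflect n p) := by
  have hcoeff : ∀ i j : ℕ, i + j = n → (reflect n p).coeff i = p.intCoeff j := by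
    intro i j hij
    rw [coeff_reflect, revAt_le (by omega), Polynomial.intCoeff_natCast,
      show n - i = j by omega]
  have hdeg : (reflect n p).natDegree = n := by
    apply le_antisymm
    · rw [natDegree_le_iff_coeff_eq_zero]
      intro m hm
      rw [coeff_reflect, revAt_eq_self_of_lt hm, ← Polynomial.intCoeff_natCast]
      exact h.zero _ (by omega)
    · apply le_natDegree_of_ne_zero
      rw [hcoeff n 0 (by omega)]
      exact (h.pos _ (by omega) (by omega)).ne'
  unfold RatioMonotone
  rw [hdeg]
  refine ⟨fun i hi => ?_, fun i hi => ?_, ?_, fun i hi => ?_, fun hn2 => ?_⟩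
  · rw [hcoeff i (n - i) (by omega)]
    exact h.pos _ (by omega) (by omega)
  · rw [hcoeff (n - i) i (by omega), hcoeff i (n - i) (by omega),
      hcoeff (n - (i + 1)) (i + 1) (by omega), hcoeff (i + 1) (n - (i + 1)) (by omega)]
    convert h.div_le_div (i := i) (j := (n - i : ℕ)) (by omega) (by omega) (by omega) using 3 <;> omega
  · rw [hcoeff _ ((n - 1) / 2) (by omega), hcoeff _ (n - (n - 1) / 2) (by omega)]
    exact h.div_le_one (by omega) (by omega) (by omega)
  · rw [hcoeff i (n - i) (by omega), hcoeff (n - 1 - i) (i + 1) (by omega),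
      hcoeff (i + 1) (n - (i + 1)) (by omega), hcoeff (n - 1 - (i + 1)) (i + 1 + 1) (by omega)]
    convert h.div_le_div' (i := (i + 1 : ℕ)) (j := (n - (i + 1) : ℕ)) (by omega) (by omega)
      (by omega) using 3 <;> omega
  · rw [hcoeff _ (n - n / 2 + 1) (by omega), hcoeff (n - n / 2) (n / 2) (by omega)]
    exact h.div_le_one' (i := (n / 2 : ℕ)) (j := (n - n / 2 : ℕ)) (by omega) (by omega) (by omega)

/-- the reciprocal `1/k`-Eulerian polynomials
`X^n * (A (n+1))(1/X)` are ratio monotone for all `n ≥ 1`. -/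
theorem stmt14 (k : ℕ) (hk : 0 < k)
    (A : ℕ → Polynomial ℝ) (hA0 : A 0 = 1) (hA1 : A 1 = 1)
    (hrec : ∀ n : ℕ, A (n + 2) =
      (Polynomial.C ((k : ℝ) * n + (k : ℝ)) * Polynomial.X + 1) * A (n + 1) +
        Polynomial.C (k : ℝ) * Polynomial.X * (1 - Polynomial.X) *
          Polynomial.derivative (A (n + 1)))
    (hdeg : ∀ n : ℕ, (A (n + 1)).natDegree = n) :
    ∀ n : ℕ, 1 ≤ n → RatioMonotone (Polynomial.reflect n (A (n + 1))) := by
  have hk' : (1 : ℝ) ≤ k := by exact_mod_cast hk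
  have hseq : ∀ n : ℕ, RatioMonotoneSeq (A (n + 1)).intCoeff n := by
    intro n
    induction n with
    | zero => simpa [hA1] using RatioMonotoneSeq.one
    | succ n ih =>
      push_cast
      refine ih.of_recurrence hk' (by omega) fun i => ?_
      rw [hrec, Polynomial.intCoeff_recurrence]
      rfl
  exact fun n hn => (hseq n).ratioMonotone_reflect hn
end
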